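/- 8 is the least integer n > 1 such that the alternating group A_5 satisfies the rewriting property P_n; that is, A_5 satisfies P_8 but does not satisfy P_n for any 2 ≤ n ≤ 7. -/

import Mathlib

/-- A group `G` has the rewriting property `Pₙ` if every sequence of `n` elements
can be rewritten by some non-identity permutation of its factors. -/
def RewProp (G : Type*) [Group G] (n : ℕ) : Prop :=
  ∀ x : Fin n → G, ∃ σ : Equiv.Perm (Fin n), σ ≠ 1 ∧
    (List.ofFn x).prod = (List.ofFn (x ∘ σ)).prod

noncomputable section
namespace Rewrite

local notation "A₅" => alternatingGroup (Fin 5)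
local infixr:75 " ◃ " => Nat.mod

/-- Evaluate `n` to a literal before passing it to `f`. -/
def ev {α : Type} (n : Nat) (f : Nat → α) : α :=
  Nat.rec (f 0) (fun k _ => f k) (Nat.add n 1)

def orB (a b : Bool) : Bool := Bool.rec b true a

def full : Nat := 1152921504606846975
/-- All elements of the set `m` satisfy `f`. -/
def allB (f : Nat → Bool) (m : Nat) : Bool :=
  Nat.rec (motive := fun _ => Nat → Bool) (fun _ => false)
    (fun _ ih m => Nat.rec true (fun k _ =>
      ev (Nat.gcd (Nat.add k 1) 1152921504606846976) fun b =>
        Bool.rec false (ih (Nat.xor (Nat.add k 1) b)) (f (Nat.mod b 61))) m) 61 m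

def sumTo (n : Nat) (f : Nat → Nat) : Nat :=
  Nat.rec (motive := fun _ => Nat → Nat) (fun a => a)
    (fun k ih a => ev (Nat.add a (f k)) ih) n 0
def prodTo (n : Nat) (f : Nat → Nat) : Nat :=
  Nat.rec (motive := fun _ => Nat → Nat) (fun a => a)
    (fun k ih a => ev (Nat.mul a (f k)) ih) n 1

def digit (t b i : Nat) : Nat := Nat.land (Nat.shiftRight t (Nat.mul b i)) (Nat.sub (Nat.shiftLeft 1 b) 1)

/-- The multiplication table of `A₅`, six bits per entry. -/
def mulDigits : Nat := 0x108310518720928b30d38f41149351559761969b71d79f8218a39259a7a29aabb2dbafc31cb3d35db7e39ebb61969b71d79f8218a30c41400421c620a24b3d044c34e4d2516557aabb25926a27a6fb6edb7e31c32d33d7be7a3d044c34e4d25165576dc75865a7de82286300108310518720928ba27a6baac9259aebedd33d77db8c31cbaef934c3924d43d04555d60400861c80c41492ca9e8a64966aeab2eb6f6dc75865a7de822863cf5d30cb1eb9ef7db818720100210314b24a9259a7a29aabb2dbaf34c3924d43d04555d665869e7e06dc7618e2cb0c79ebbcf5d36e379e8a64966aeab2eb6f49350d30e40f4575561872010021031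4b24a7de81c6dd6586a38a1eb9ef5cf4cb0c78df610314718800108a2c965869e7e06dc7618e29649aaaec9e8a6dbee30d38f411493515597c72c36e37e7beb3d359649aaaec9e8a6dbee1c62040c504008b28979f81961a71b76386249350d30e40f457556e7beb2c70e36df5cf479f81961a71b763862aabb25926a27a6fb6e10314718800108a2c940f45349430d3965d5e36dfbe7ac72c34d7371b75f7a06196a28e140f45349430d3965d5aeab289e99649afbad0c41400421c620a24bdf8db4d73efae71c324d25103d134c397595a27a6baac9259aebed71b75f7a06196a28e10400861c80c41492cad74cfaef9df8db0cb1aeab289e99649afbad7de81c6dd6586a38a14d25103d134c3975951c62040c504008b289efae78df6d74cf2c7030e34f4505565d24d400204314424a2c61c86dd7186998a18df7a0cf4d70c72df6e3ae7b9e8a64966aeab2eb6f0c51000812892c718861a65b75c8628de7e030e34f4505565d24d4c70cb6df8cf4d79efa9649aaaec9e8a6dbee6dd7186998a18df7a03d140c38d5955d34940c51000812892c7188df6e34cf5c70cbbeb9aeab289e99649afbad08004928b0c510620738c3555973d1412513c31cb3d35db7e39ebb61a65b75c8628de7e0926967a68b6ebeaaecc31cb3d35db7e39ebb24a2c2001143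1081875565ce30d44f4144938628da61975b72079fb6ebe6925a67a2caab5565ce30d44f414493cf4d70c72df6e3ae7b08004928b0c510620775b72286361a65f81ea67a2eb6f92696bb2a6986618a36dd71e81f14310a24b002047206db7e31c32d33d7be7a3d140c38d5955d3494aacae59a4bedba89e92892c50c40800481c6c70cb6df8cf4d79efa6986618a36dd71e81f38c3555973d14125139a592dbeeaacae7a68db7e31c32d33d7be7a8628da61975b72079f2892c50c40800481c65955d13d038c3544d2bedbacaab9a5929a2744f41655730e35351275b72286361a65f81ed33d77db8c31cbaef900204314424a2c61c8a299ebb2abafb64966d33d77db8c31cbaef95955d13d038c3544d28a18dd6dc6986607de24a2c2001143108187bafb69a27b2baa69258a18dd6dc6986607dedf6e34cf5c70cbbeb944f41655730e35351214310a24b002047206b2baafbada299e59a404200620724b28310534e31251355758f411926967a68b6ebeaaecc32c73d74e7aef6df861969b71d79f8218a3926967a68b6ebeaaec1881c10802c92840c54944cd38c5d55903d1e7aef2c31d73d38db779f81961a71b7638624944cd38c5d55903d19e9a249a5badbebaac04200620724b283105d73d3ae7bc32c77e3671b75f7a06196a28e138d3155d64944cf4500810092ca1881c3144cf5d30cb1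eb9ef7db89e9a249a5badbebaac6dd7186998a18df7a024b2820402061c50c4c32c73d74e7aef6df838d3155d64944cf4509a496dbaf9e9a2ab2b6986618a36dd71e81fcf5d30cb1eb9ef7db855758e34c5124d13d024b2820402061c50c4badbe99e89a496caea8a18dd6dc6986607de2061cb24a0420041439a496dbaf9e9a2ab2bcb0c79ebbcf5d36e3734e31251355758f41165a61e81f86389b71dcb0c79ebbcf5d36e372c9288187081005103b6ebe6925a67a2caab55758e34c5124d13d086389a65881e7dd6dcb6ebe6925a67a2caabe7aef2c31d73d38db72061cb24a0420041435124d755634e31044f81e7e386265a61c75ba67a2eb6f92696bb2a5124d755634e31044feb9ef5cf4cb0c78df61881c10802c92840c57e079c75b8e285961a5d559449338d31140fd73d3ae7bc32c77e36a67a2eb6f92696bb2a0810092ca1881c314475c6e28e17e0798699eb9ef5cf4cb0c78df6badbe99e89a496caea5d559449338d31140f2c92881870810051038e28607de75c6da65865a61e81f86389b71d1050c720628b240042aacae59a4bedba89e9db8df1cb0ef9eb4cf53d044c34e4d25165571c81841432ca24100296692ab2bb6fba7a2965a61e81f86389b71dcb1c39efadb8df3d7434c3924d43d04555d6aacae59a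4bedba89e97a07d96988e189c6dd1c81841432ca241002ef9eb8db7cb1c35d334d25103d134c3975951440ca2c91c81800816996218e27a07db75cc72c36e37e7beb3d3596692ab2bb6fba7a2930e34f4505565d24d4c72c36e37e7beb3d3528b24510320718200186389a65881e7dd6dcb6fba6964b2aae99e85565ce30d44f41449386389a65881e7dd6dcdb8df1cb0ef9eb4cf51440ca2c91c8180081b2aaefb6e966928a6744f41655730e3535129a592dbeeaacae7a6820718b2891050c1080e7beb2c70e36df5cf47a07d96988e189c6dd4944cd38c5d55903d12ca2481c61440c2040cb1c39efadb8df3d749a592dbeeaacae7a686996218e27a07db75c38d3155d64944cf450e7beb2c70e36df5cf4b6fba6964b2aae99e82ca2481c61440c20408e18a079f69961d71b5d559449338d31140f81e7e386265a61c75bb2aaefb6e966928a67e36dfbe7ac72c34d731050c720628b2400424113d351259754c34ee36dfbe7ac72c34d738e18a079f69961d71bbedbacaab9a5929a2728b24510320718200159755140f51348e30dbedbacaab9a5929a27ef9eb8db7cb1c35d3381e7e386265a61c75b20718b2891050c10805134975954113cd38c4113d351259754c34e71d6df81e8a385865aa299ebb2abafb64966d35cf7e36ebbe70c7200108310518720928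ba299ebb2abafb649664d449044f5d654d30e7e079c75b8e285961aebbe75d33e37db2c3118720100210314b24a7e079c75b8e285961aaecaa8a67beeb659264113d351259754c34ee37dbbeb9d35cf1cb010314718800108a2c975c6e28e17e07986994503d65d54d448c38ddf8db4d73efae71c32aecaa8a67beeb659260c51000812892c718859755140f51348e30dd35cf7e36ebbe70c7275c6e28e17e0798699a689eebedaecaa49a508004928b0c5106207df8db4d73efae71c328a385d71b81f79a61959755140f51348e30dbeeb6caeaa689e69642892c50c40800481c65134975954113cd38ca689eebedaecaa49a5d74cfaef9df8db0cb171d6df81e8a385865a04200620724b283105d74cfaef9df8db0cb15d65544d24503ce34cbafb69a27b2baa69258a385d71b81f79a61924b2820402061c50c4bafb69a27b2baa6925ebbe75d33e37db2c315134975954113cd38c81f7a38a171d6d96982061cb24a042004143b2baafbada299e59a481f7a38a171d6d9698efae78df6d74cf2c704d449044f5d654d30e1c81841432ca2410028e28607de75c6da658e37dbbeb9d35cf1cb0b2baafbada299e59a44503d65d54d448c38d1440ca2c91c8180081efae78df6d74cf2c70beeb6caeaa689e69648e28607de75c6da6585d65544d24503ce34c2ca2481c61440c2040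
def invDigits : Nat := 0xeec8eeddfd68754590bf883aae2a747174d1e6a86dd9ece76d254f9b167295a93060e34c2c71482842460c1080
def rankDigits : Nat := 0x1087812095112701ce46098940922209872414861c481244449c4743180625104a90a62100201ab238e31ac2d3b9c024c8534cab9b44b59ca114c016980e1b5d331c421186408ca5398202340b3ac811b86d3b9d3134461b4c004c8b710a53cdc69956b0b413088e2214c718c25104c03ad60234830b46e2026e22ce52b8d3738ed988c3101a659673081ab088e2218a20946339820810e40120a49d246104481d8a4090739c02231286084912447408e44818c6212c4292a821002396d200e31b42b14dab3ac4508033738f3010a622e65019b3339ae1884710cc729423204c081c8481c0949144610476080949d02209823b129008e83a8e4408444320c8210c4290a6252048c2350d2088623494c55152091a4530d012a251484cf0c826898657a109445e893def5464050c6148d3100e214186540532899e1299252a812494d20c82578cc68a50843e2a7be4f44a2022dcd3b4811806b14dae100e63386d5805399ca112da1596602ba6e3108738424314c311460484634855188c03494c64051278e21299213224f40471280a5918c59254954a488be2f43de03b5ae22c830ac6012c133cc450b42b9b440708c63b5c39956e34dc029c843842230cc520ca001ce46098940922010878120951127392041310a608e8224e2488e2431808254c4a148621003b9c024c8534cab2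01ab238e31ac2d5acf3688251026170dad3026e308e22046230ca5384c03b9d3134461b4c02340b3ac811b86d5b880990a53ba66585b32ae6009c4238c64298a1118202026e22ce52b8d33ad60234830b46e6cc4e71c66134069840b2cd6d09c42104a431463384c06104481d8a40907810e40120a49d241118738109608493a042488874b00c6214c425498210014dab3ac45080332396d200e31b42b9808e71cc524d65999c0335cd18847394a21986121820610476080949d0281c8481c094914411d841312901c482204751c824418c621504214862520494c55152091a4548c2350d2088623095061a2324982f344c1904a37a109449e88bdef54a204186540532899e150c6148d3100e212954532640498b22bc61904c68a12853de87c5f24464014dae100e63386d22dcd3b4811806b9cceb0082513561015cb2cdd331087218a70846610ca0494c64051278e21484634855188c0309905325f240c312c8c5014a692929445ea949f143de012c133cc450b42b3b5ae22c830ac6003853688c63b9a371a732ac0e290e411867084a62146024c0e3b8862acb33ad6d14c412cc200348e590633b56168dce34c0d308e220c27294c3118201366e3b843300cd22dd3200e52ccce6808b59c23235c3685600cd732884738c62284a6204c06088701d884892281c826118851d02210043c12a81c893a48241c424818c8292c52128621003ad6d14c412cc2024c0e3b8862acb372c80690633ada171a6d1b9a031c42394a418466104c022dd3200e52ccce1366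e3b843300cd5aced01061239a30066d0ae6b288471142718cc52182081c826118851d026088701d884892221e0420149810e9120e7490424b00c629105250962100514a64953201646404a341931905e6185231a81148c31344c3794219250843e4a7be2f44640404a341931905e6514a6495320164618d430a620484711bca6898219212853de87c9f144a20608e26100948907608e2610094890739207241290108a12082410e7531906290c52108825203ce6012c412ac2d101cd14ce63346e6b4eb7106120163999ce28173290e410cc42982138ca0101cd14ce63346e3ce6012c412ac2d5b88d69c2322c037141333a6b29c84214c21982139460404c64950f90623404c64950f9062308d211a63150c60348a6914a50252a43e287c65253de01366b100e10acb3239733cc86280ae6b4ee008c314dc600d6e1b56d0908720467318a111460498a5499529140548c214191179646185260a22f418b218063884238a5495462893e4f43de010173134e10ccab3b5a0138461b8d372c9399cc52380558c0d0adae19c8420c22284c638ca0239733cc86280ae1366b100e10acb37004d69c6613a6670da01adab09087398c408c2510ca048c214191179646498a54995291405305030a5f1414d21c42300c618a929449ea8c5f243de03b5a0138461b8d310173134e10ccab9ccee590a6201c56856b181cd190e411424184c6394601380d3b44334cce3ce6b23885338a002c4d988213ae65585ad1b80b190e4104a73186120ca03ce6b23885338a01380d3b44334cce6cc40588213cd6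568dcb0b56019c84398c209423214604182148d0f89a454182148d0f89a45315262a652514a00c46188c630252a43e487ca3153de061c420098849127608e760a08411441080713128610e9224e45108748210621304212862940608e760a084114461c420098849127389821010961c892288449ce44c0108210c42509629400084261d8941d240084261d8941d2411d823b1088108a3a48749084542006250c4a108829406088460a0841d47810e261d885110221e071310a6088822887408474320c025204a52902520498a640d1178641484614151279a2618d452a9ef50caf0c466914267a1094822904a514c64040cc54990f8864150c655154f795e308d250a24f418d11c426784a6925084c409944124ca20810e261d88511026088460a0841d47389843c148610483a044510e24418c025204a52902520484614151279a26498a640d1178641295431a9ef5146f348a188cc17a10948249046324ca2050c655154f795e340cc54990f88641285011a5f2418d133c23884c5921284ca29882404c640414234850f91a26514a350d4f78de5315233222f404322c8c1798618a5084c8098c8114c640514a350d4f78de5414234850f91a26199062a5f1404320bcc5918238a1284c649902204ca2061c478118a4090461c478118a40904111822310881cea120e241c8453190025204a529025204182640531915e3404c14193288de5305013223248caf2bc63794657a94a4c6499463248000404c14193288de54182640531915e3099060a2514946f1bca578ca37a94a4ca298ca5148000000000000000000000000000000000000000000000000000000000000000000000000000000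
/-- Offsets of pairwise coprime moduli above `2 ^ 60`, used to store tables by Chinese remaindering. -/
def codeDigits : Nat := 0xb3765ec7d83af359eaad41a6b4a685cf39df3b674ce79b73565fcbd9632b650c9f90720637c6b8b314e26c4587f0ee1cc3385f06e0bc11806ffdfcbed7caf65ddba5746e7dceb99722e2dc3b816f6da5b3b5d6aed3da5b4566ec6d8cb13612c1d7eaf55d2b7d69ad159ab1d60ab9566abd50a9b52a9e53ba734e297d2da5349291d20a3746a8c515a294468750ca013f67d4f09d1392714de9b335669cd299331a624c19812fa5bcb29632b255ca694b28a4ec93923236454879051fe3f4738e11b2354698c91822c45289d12e24c4688710a1fc3c8750d21742d8550a212c2484307e0f41c82d04a0840f81902a03c0680900e00c01001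
/-- Inverses that give the Chinese remaindering basis. -/
def crtDigits : Nat := 0x515b0c3e47d5091b605e80984d2f2bc76aba194d2c2318b5a80d5133b5b333e87ae9bc38f26eb4b78d43032557b44f3a9d9601723be1e9d8711eb898815e14f5f624832fe3fecc071ba9f668043581ab90803d9416e601e3b60f7730115e0b9935799d202d694291d12888a521a382287b36e471e86beab212020f43f2bbb19f7528b0a46f89968ef306a86730fa55ea0e54b6246098a71720c47887e0ac6a310c012d8dd8978b154620605dd309f8e6ae9083edf480672c071382160642b3c48292ed5dfbe546a5cb77c12ba6a690397227fd239c560d1122d0b9cbd33a3f348dbe0536a557f1aa6346db6f8a8a075ddb68732612f76edcf4ea13d26fdb024e451e21177c6b15276e6082ec9e614655222c6397b7eec873b10118098dc9db37f22cbd8d5834535830aa3cbdeb3f2f6eb849cd8bc87fb444f9699ea7a32391920e201ff42b7f27145cfe8ba04645155661228ebbe16f54a84869ec8595cba8080c52f7a17b99857b09a09fc3f7896cdafb06735156b153f16956c785811050548ba85ef778b3c8ba7ae1c5b4e69bbcfc51dfbddb8742bc26be99cd311a83c434583172052200d09424cfbc2a139e1c92a501a1558d3d39fd5f27dda7fc0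cfc3418a456219ca031dd11e18ea4e629e2157807d98c461f59c6fda0375c3be346716b600654e1150e3f3e6c466ce5bdac2a06ee9040dd5cbd0e1f99ed245b50541ff36494f5c8cfa7df310a8975464b14761eae92da95c59f29237643b2102db3af91377b153a2cfb4d48c1e037c254e65a46abed4f9df1d59c28e75e9c1c30ba7920e26113603b293d6faad58590cf620d54e5652e5fbd66e11c40436c539c39743224217a9d6335403e312a9864ef3bbc379c7011cf29e38b96f12b9fd391320aa5e6c31a2aa3f4b31f10b989403546a40706f5cbdf913f0512bea9b40216f52979090dcb11d6c36b789b436c974a5b97bb01fc3402b03e3494ec879c84341ca57d21a2938d93c82749baa6922df94e0f51755c98e341ac4a9d08d8642f215aa2354ef5892d6c041dad000b8071c5ec9746c1e853aa244f4ba6b8f291d8d64d5997ab828b82fcd9d75b8814b624eca6a045816f04f6fb4a0cb16c8e1aed8ce31fc9923761f927326bc1821caeedc9b6380a6f0581947b3193ce2be7d1048358331ec6f3ae7d44504b69cbaaa92a40aa09c098758b49193fd92866441b1732aeb0dfa832935a9bc7588a9036bfb0102050019ac44d46e3f18c70b337a217b96526442890e986f68e7b0efdcfaee5e429fdf6f6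977c3bc99d06f97048e5019ce43dc9c81874d1aee5811dda2ba41c36a8432ea593fc2f18f870b4bcb6c7a4419c4a6977f4a0a9b97ae0255748f28c5ed970267d8bcef43f92c0e520332d178331c12aaec326bc51406badc7ac9399bbb4a70c6d131c51b5227337016e9738e5459ce60e7bb40b65b9906dc0b96fa737583e2ed5feaada6f0ed3a0eb2f7d89d5e01702f499a07b3b05d5b3f23306d5711646fb79be3faa720b689bb89804fd6547693afbcabceaf549c5330e6ab4b0201d569132c3a03c0d3abb33910246df48e6cb5ec7a2f821860d44b7d8749a4403d77f852bc2ff002f38f9e365b7a061adc460b5f93388e9da41537a0986ef1087d8234b530d1a025f85e07e1500fec0bc7c611d467d1962e6de6a18ccc9afd0a17920ffa0c7d0f06cb982e7064798c6a979b32673ee0d0199ac5692f915bb04ede91831b5401788c097a3f19fe651d35323b6f37080f0036b6dda082c2cdf136bc3ba7711893299a71715cc4ea9310c7b1302bf6e5fa9c678a19df1571b283d9a9b80c1e1c595fb46da8ee2ab77d1ae2217e2b8de411b5c9da2399d826ae26030096de62ae2a009cd4d1aa88be10a19667b1568e411a117da14244e9ff8143dc26742f87dd2bdc6a71cd469c4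6c4d8

def code (i : Nat) : Nat := Nat.add 1152921504606846976 (digit codeDigits 11 i)
def c2 (t : Nat) : Nat := code (Nat.sub t 1)
def c1 (t : Nat) : Nat := code (Nat.add t 59)
def c0 (t : Nat) : Nat := code (Nat.add t 119)

def prodTo01 : Nat := prodTo 120 fun i => code (Nat.add i 60)
def prodTo2 : Nat := prodTo 60 code
/-- Chinese remaindering basis for the codes `60, …, 179`. -/
def basis01 (i : Nat) : Nat :=
  Nat.mod (Nat.mul (Nat.div prodTo01 (code i)) (digit crtDigits 61 i)) prodTo01
/-- Chinese remaindering basis for the codes `0, …, 59`. -/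
def basis2 (i : Nat) : Nat :=
  Nat.mod (Nat.mul (Nat.div prodTo2 (code i)) (digit crtDigits 61 i)) prodTo2

def mulLabel (i j : Nat) : Nat := Nat.add (digit mulDigits 6 (Nat.add (Nat.mul 60 (Nat.sub i 1)) (Nat.sub j 1))) 1
def invLabel (i : Nat) : Nat := Nat.add (digit invDigits 6 (Nat.sub i 1)) 1

def mapRow (f : Nat → Nat) : Nat := sumTo 60 fun i => ev (f (Nat.add i 1)) fun k =>
    Nat.add (Nat.mul (basis01 (Nat.add i 60)) (c2 k)) (Nat.mul (basis01 (Nat.add i 120)) (c1 k))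
/-- Row of right multiplication by `j`. -/
def R (j : Nat) : Nat := mapRow fun i => mulLabel i j
def invTable : Nat := mapRow invLabel
def idxTable : Nat := sumTo 60 fun i => Nat.mul (basis2 i) (Nat.add i 1)
/-- The label with a given code of level 2. -/
def ix (w : Nat) : Nat := Nat.mod idxTable w
/-- row of `v⁻¹`, entry of `w`: the set of `x` with `x v x⁻¹ = w`. -/
def T (j : Nat) : Nat := ev (invLabel j) fun v => sumTo 60 fun k =>
    ev (Nat.mod (Nat.shiftLeft 1 k) 61) fun x =>
    ev (mulLabel (mulLabel x v) (invLabel x)) fun w => Nat.shiftLeft (basis2 (Nat.sub w 1)) k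
def rankRow (t : Nat) : Nat := digit rankDigits 300 (Nat.sub t 1)
def iv (t : Nat) : Nat := ix (Nat.mod invTable (c1 t))

/-- Row of the product `b a` -/
def P (a b : Nat) : Nat := ev (ix (R a ◃ c1 b)) R
/-- The conjugation row of a product of two elements. -/
def T2 (a b : Nat) : Nat := ev (ix (R a ◃ c1 b)) T
def T3 (a b c : Nat) : Nat := ev (ix (R a ◃ R b ◃ c0 c)) T
def T4 (a b c d : Nat) : Nat := ev (ix (P a b ◃ R c ◃ c0 d)) T

/-- Entries of the row `t` at the products of `v` with `a` and `b` in both orders. -/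
def A2 (t v a b : Nat) : Nat := Nat.lor (t ◃ P a b ◃ v) (t ◃ P b a ◃ v)
/-- Entries of the row `t` over all orders of three letters. -/
def A3 (t w a b c : Nat) : Nat := Nat.lor (A2 t (R a ◃ w) b c) (Nat.lor (A2 t (R b ◃ w) a c) (A2 t (R c ◃ w) a b))
def A22 (t w a b c d : Nat) : Nat := Nat.lor (A2 t (P a b ◃ w) c d) (A2 t (P b a ◃ w) c d)
/-- Entries of the row `t` over all orders of four letters. -/
def A4 (t w a b c d : Nat) : Nat :=
  Nat.lor (Nat.lor (Nat.lor (A22 t w a b c d) (A22 t w c d a b)) (Nat.lor (A22 t w a c b d) (A22 t w b d a c)))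
    (Nat.lor (A22 t w a d b c) (A22 t w b c a d))
def lor3 (a b c : Nat) : Nat := Nat.lor a (Nat.lor b c)

def F2 (x y w : Nat) : Nat :=
  lor3 (Nat.lor (T x ◃ R y ◃ c1 w) (T y ◃ R x ◃ c1 w)) (T2 x y ◃ c2 w) (T2 y x ◃ c2 w)
def F3one (a b c w : Nat) : Nat :=
  lor3 (A2 (T a) (c1 w) b c)
    (Nat.lor (T2 a b ◃ R c ◃ c1 w) (T2 b a ◃ R c ◃ c1 w))
    (Nat.lor (T3 a b c ◃ c2 w) (T3 a c b ◃ c2 w))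
def F3 (a b c w : Nat) : Nat := lor3 (F3one a b c w) (F3one b c a w) (F3one c a b w)
def F4pair (x y z d w : Nat) : Nat :=
  Nat.lor (T2 x y ◃ P d z ◃ c1 w)
   (Nat.lor (lor3 (T3 d x y ◃ R z ◃ c1 w) (T4 z d x y ◃ c2 w) (T4 d z x y ◃ c2 w))
     (Nat.lor (Nat.lor (T3 x d y ◃ R z ◃ c1 w) (T4 z x d y ◃ c2 w))
       (Nat.lor (T3 x y d ◃ R z ◃ c1 w) (T4 z x y d ◃ c2 w))))
def F4one (x y z d w : Nat) : Nat :=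
  lor3 (Nat.lor (A2 (T x) (R y ◃ c0 w) z d) (A2 (T x) (R z ◃ c0 w) y d))
    (Nat.lor (A2 (T2 x d) (c1 w) y z) (A2 (T2 d x) (c1 w) y z))
    (Nat.lor (F4pair x y z d w) (F4pair y x z d w))
def F4 (x y z d w : Nat) : Nat :=
  Nat.lor (A3 (T d) (c0 w) x y z) (lor3 (F4one x y z d w) (F4one y z x d w) (F4one z x y d w))

def F5aone (x y z d e w : Nat) : Nat :=
  lor3 (A2 (T d) (P y x ◃ w) z e) (A2 (T d) (P z x ◃ w) y e) (A2 (T d) (P e x ◃ w) y z)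
def F5a (x y z d e w : Nat) : Nat :=
  Nat.lor (A4 (T e) w x y z d)
   (lor3 (F5aone x y z d e w) (F5aone y z x d e w) (F5aone z x y d e w))
/-- Words starting with `y`, and ending in `d` or without the factor `d e`. -/
def A3' (t y x d e w : Nat) : Nat :=
  lor3 (A2 t (P d y ◃ w) x e) (t ◃ P d x ◃ P e y ◃ w) (t ◃ P e d ◃ P x y ◃ w)
def F5bone (t y z d e w : Nat) : Nat :=
  Nat.lor (Nat.lor (A3' t y z d e w) (A3' t z y d e w))
    (lor3 (A2 t (P y d ◃ w) z e) (A2 t (P z d ◃ w) y e) (A2 t (P e d ◃ w) y z))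
def F5b (x y z d e w : Nat) : Nat :=
  lor3 (F5bone (T x) y z d e w) (F5bone (T y) z x d e w) (F5bone (T z) x y d e w)
/-- two letters in `v` -/
def F5v (t y z e w : Nat) : Nat := Nat.lor (A2 t (R y ◃ w) z e) (A2 t (R z ◃ w) y e)
def F5w (t x d e w : Nat) : Nat := Nat.lor (A2 t (R d ◃ w) x e) (t ◃ P e d ◃ R x ◃ w)
def F5cone (x y z d e w : Nat) : Nat :=
  lor3 (Nat.lor (A3 (T2 x e) w y z d) (A3 (T2 e x) w y z d))
    (Nat.lor (F5v (T2 x d) y z e w) (F5v (T2 d x) y z e w))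
    (Nat.lor (F5w (T2 y z) x d e w) (F5w (T2 z y) x d e w))
def F5c (x y z d e w : Nat) : Nat :=
  Nat.lor (A3 (T2 e d) w x y z) (lor3 (F5cone x y z d e w) (F5cone y z x d e w) (F5cone z x y d e w))

def nb (E c : Nat) : Nat := Nat.shiftRight E (Nat.mul 60 c)
def loops (E r : Nat) (f : Nat → Nat → Nat → Bool) : Bool :=
  allB (fun c => ev c fun c => ev (Nat.land r (nb E c)) fun s =>
    allB (fun d => ev d fun d => allB (fun e => ev e fun e => f c d e) (Nat.land s (nb E d))) s) r
def dead (E r : Nat) : Bool :=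
  allB (fun c => ev (Nat.land r (nb E c)) fun s =>
    allB (fun d => Nat.beq (Nat.land s (nb E d)) 0) s) r

/-- Row of a product of inverses -/
def Q (a b : Nat) : Nat := ev (iv (ix (R a ◃ c1 b))) R
def halves (a b c d e f g h p : Nat) : Bool :=
  Nat.beq (Q c d ◃ Q a b ◃ c0 1) (P e f ◃ P g h ◃ c0 p)
/-- Some rearrangements of eight letters. -/
def wordTable {α β : Type} (H : α → α → α → α → α → α → α → α → β) :
    List (α → α → α → α → α → α → α → α → β) := [
  fun a b c d e f g h => H a b c g h e f d,
  fun a b c d e f g h => H a b c g e f d h,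
  fun a b c d e f g h => H g h f a b c d e,
  fun a b c d e f g h => H h g a b c d e f,
  fun a b c d e f g h => H h f g a b c d e,
  fun a b c d e f g h => H f g h e a b c d,
  fun a b c d e f g h => H a b c h e f g d,
  fun a b c d e f g h => H g h e f a b c d,
  fun a b c d e f g h => H a b c d g f e h,
  fun a b c d e f g h => H a b c d g h f e,
  fun a b c d e f g h => H h e f g a b c d,
  fun a b c d e f g h => H g f a b c d e h,
  fun a b c d e f g h => H a b c g f d e h,
  fun a b c d e f g h => H a b c d e h g f,
  fun a b c d e f g h => H a g f b c d e h,
  fun a b c d e f g h => H a b c d e g f h,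
  fun a b c d e f g h => H a b c d e g h f,
  fun a b c d e f g h => H a b c g h f d e,
  fun a b c d e f g h => H a b c d e h f g,
  fun a b c d e f g h => H a b c d e f h g,
  fun a b c d e f g h => H a b c d g e f h,
  fun a b c d e f g h => H a b c d h f g e,
  fun a b c d e f g h => H a b c d h e f g,
  fun a b c d e f g h => H g e f a b c d h,
  fun a b c d e f g h => H a b c h f g d e,
  fun a b c d e f g h => H a b c d h g e f,
  fun a b c d e f g h => H f g e a b c d h,
  fun a b c d e f g h => H a b c h g d e f,
  fun a b c d e f g h => H a b c d g h e f,
  fun a b c d e f g h => H f e a b c d g h,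
  fun a b c d e f g h => H a b g h e f c d,
  fun a b c d e f g h => H a h g b c d e f,
  fun a b c d e f g h => H a b h g c d e f,
  fun a b c d e f g h => H a b g h f c d e,
  fun a b c d e f g h => H a b g e f c d h,
  fun a b c d e f g h => H a b g f c d e h,
  fun a b c d e f g h => H a h f g b c d e,
  fun a b c d e f g h => H a g h f b c d e,
  fun a b c d e f g h => H a b h e f g c d,
  fun a b c d e f g h => H a g e f b c d h,
  fun a b c d e f g h => H a h e f g b c d,
  fun a b c d e f g h => H a g h e f b c d,
  fun a b c d e f g h => H a b h f g c d e,
  fun a b c d e f g h => H a f g h e b c d,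
  fun a b c d e f g h => H h a c d e f b g,
  fun a b c d e f g h => H a b f g h e c d,
  fun a b c d e f g h => H a f g e b c d h,
  fun a b c d e f g h => H h e b g f c a d,
  fun a b c d e f g h => H a b f g e c d h,
  fun a b c d e f g h => H a b c h g f e d,
  fun a b c d e f g h => H g a c d e b f h,
  fun a b c d e f g h => H d a c b g f h e,
  fun a b c d e f g h => H b c d a e f h g,
  fun a b c d e f g h => H a g f d h c e b,
  fun a b c d e f g h => H e d a b h g f c,
  fun a b c d e f g h => H f d g c b e h a,
  fun a b c d e f g h => H a d e h b f c g,
  fun a b c d e f g h => H d a c b e g h f,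
  fun a b c d e f g h => H g h f e d a b c,
  fun a b c d e f g h => H d b c e f h a g,
  fun a b c d e f g h => H a b f e c d g h,
  fun a b c d e f g h => H e d h c a b g f,
  fun a b c d e f g h => H g h e d f b c a,
  fun a b c d e f g h => H a d e h f b g c,
  fun a b c d e f g h => H h g d e b c f a,
  fun a b c d e f g h => H a h e b g c d f,
  fun a b c d e f g h => H h g f d c e b a,
  fun a b c d e f g h => H h a c b g d f e,
  fun a b c d e f g h => H a g f h b e c d,
  fun a b c d e f g h => H e g f h a b c d,
  fun a b c d e f g h => H c b d a f h g e,
  fun a b c d e f g h => H h e c d a g b f,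
  fun a b c d e f g h => H f e g d b c a h,
  fun a b c d e f g h => H g h f e d c a b,
  fun a b c d e f g h => H e d b c a h g f,
  fun a b c d e f g h => H a h c e d f g b,
  fun a b c d e f g h => H b d a h f e c g,
  fun a b c d e f g h => H f c d e g b h a,
  fun a b c d e f g h => H b g f d e a c h,
  fun a b c d e f g h => H g b c a e h f d,
  fun a b c d e f g h => H c d g e h a f b,
  fun a b c d e f g h => H g d a c h e f b,
  fun a b c d e f g h => H c e d g f a h b,
  fun a b c d e f g h => H f a h d c e b g,
  fun a b c d e f g h => H c d e a h b g f,
  fun a b c d e f g h => H e h b g a f d c,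
  fun a b c d e f g h => H a b g f e d c h,
  fun a b c d e f g h => H d c e f h g a b,
  fun a b c d e f g h => H f h c d a b g e,
  fun a b c d e f g h => H g h f e c d a b,
  fun a b c d e f g h => H f b d g e a c h,
  fun a b c d e f g h => H a h d f b c g e,
  fun a b c d e f g h => H g a b c h f e d,
  fun a b c d e f g h => H f c b h g d e a,
  fun a b c d e f g h => H f a c d h b g e,
  fun a b c d e f g h => H f e a h g d b c,
  fun a b c d e f g h => H g f c d e b a h,
  fun a b c d e f g h => H f a b h d e c g,
  fun a b c d e f g h => H a f e d c b g h,
  fun a b c d e f g h => H h e d b f c g a,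
  fun a b c d e f g h => H c h a b g f d e,
  fun a b c d e f g h => H g a b f e d c h,
  fun a b c d e f g h => H d c g b a e f h,
  fun a b c d e f g h => H h f b e d g a c,
  fun a b c d e f g h => H a c b h g e f d,
  fun a b c d e f g h => H a b d g f e h c,
  fun a b c d e f g h => H h b g d e c f a,
  fun a b c d e f g h => H f c h e d g a b,
  fun a b c d e f g h => H h d c b f e a g,
  fun a b c d e f g h => H f b c e g a h d,
  fun a b c d e f g h => H a f e b c d g h,
  fun a b c d e f g h => H a b h g f e d c,
  fun a b c d e f g h => H d b g a e f h c,
  fun a b c d e f g h => H h e b g a d c f,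
  fun a b c d e f g h => H g b d f e h c a,
  fun a b c d e f g h => H f b d a g h c e,
  fun a b c d e f g h => H f h g e c a b d,
  fun a b c d e f g h => H g h d a e b c f,
  fun a b c d e f g h => H f a g d e c h b,
  fun a b c d e f g h => H g f h d a c b e,
  fun a b c d e f g h => H c d b e a g h f,
  fun a b c d e f g h => H g a b h e d c f,
  fun a b c d e f g h => H g f b h a c d e,
  fun a b c d e f g h => H f g h e d c a b,
  fun a b c d e f g h => H h e f a c g d b,
  fun a b c d e f g h => H d g c b f e a h,
  fun a b c d e f g h => H c h b g f d e a,
  fun a b c d e f g h => H d e g c f a b h,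
  fun a b c d e f g h => H a c e f g d h b,
  fun a b c d e f g h => H e a g c d h b f,
  fun a b c d e f g h => H d f h a e g b c,
  fun a b c d e f g h => H b g d c f e h a]
/-- Some element of the list satisfies `f`. -/
def anyOf {α : Type} (f : α → Bool) (l : List α) : Bool :=
  List.rec false (fun w _ ih => Bool.rec ih true (f w)) l
def someWord (a b c d e f g h p : Nat) : Bool :=
  anyOf (fun w => w a b c d e f g h p) (wordTable halves)

/-- inverse of the letter from p to q -/
def step (p q : Nat) : Nat := ix (R p ◃ invTable ◃ c0 q)
def dif (d f : Nat) : Nat := Nat.xor d (Nat.land d f)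

def final (x y z d e b : Nat) (p q r : Nat) : Bool :=
  ev (step b p) fun f => ev (step p q) fun g => ev (step q r) fun h => someWord x y z d e f g h r

def graph (x y z p3 D : Nat) (k : Nat → Bool) : Bool :=
  Nat.rec (motive := fun _ => Nat → Nat → Bool) (fun _ _ => false)
    (fun _ ih E m => Nat.rec (k E) (fun m _ =>
      ev (Nat.gcd (Nat.add m 1) 1152921504606846976) fun b => ev (Nat.mod b 61) fun q => ev (step p3 q) fun d =>
        ev (Nat.lor E (Nat.shiftLeft (dif D (F4 x y z d q)) (Nat.mul 60 q))) fun E' => ih E' (Nat.xor (Nat.add m 1) b)) m)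
    61 0 D

def low (c y z : Nat) : Bool := Nat.ble (digit (rankRow y) 5 (Nat.sub z 1)) c

def edges (c x y z p3 D E : Nat) : Bool :=
  allB (fun a => ev a fun a => ev (step p3 a) fun d =>
    orB (low c z d)
    (ev (Nat.land full (nb E a)) fun Ea =>
     allB (fun b => ev b fun b => ev (step a b) fun e =>
       orB (low c d e)
       (ev (Nat.land Ea (nb E b)) fun r => orB (dead E r)
        (ev (dif r (F5a x y z d e (c0 b))) fun r => orB (dead E r)
        (ev (dif r (F5b x y z d e (c0 b))) fun r => orB (dead E r)
        (ev (dif r (F5c x y z d e (c0 b))) fun r =>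
          loops E r (final x y z d e b)))))) Ea)) D

def node (c x y z p3 D : Nat) : Bool :=
  ev (dif D (F3 x y z p3)) fun D => graph x y z p3 D fun E => edges c x y z p3 D E

def search (c x y : Nat) : Bool :=
  ev (iv (ix (R x ◃ c1 y))) fun p2 =>
  ev (dif full (F2 x y p2)) fun D =>
  allB (fun q => ev q fun q => ev (step p2 q) fun z => orB (low c y z) (node c x y z q D)) D

/-- The images of the labelled permutations. -/
def permDigits : Nat := 0x5388170a0e10d40ca8c850266308c4c188b10b4234442146118d111831380a6604d085888b8816540e141a84305c4c188b11111a10b5086838540ca7014cc08c61464241c21a85a1085198132a06588888d18c229c06260b88129c0ca81330231831311160b8842d070a0d4214644688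
/-- The labels of the conjugates under a transposition. -/
def outerDigits : Nat := 0xbedba38622ca257595ef9ea079f2071944d2e36decaab1440d140fcb1c2696469960e34cd74ce9a2775c6c2040
/-- A symmetry that maps a pair to its representative. -/
def symmetryDigits : Nat := 0x213655275536a7a56ade36005e6a27275521d59d5ea121127312737312b4a6731212e06ab6365eea212727ec6a5e0036f391219287889655cec200a70034149714a5a79a21de14b3242100b7249ad5cb04df243424f404349fc4d6c82100f804eb0034b7210414fb91eecfd9db9787e487e9f18bcec20092160019ab16a5c6a516a23695360616d606c4cfb519df000006a22929b5cad4b22919ef19eb0636ea290036e3fa9ddb85f3f2879285f4d9e6cec200de754500e975c6c6a562f675f6006552d652c9b0a845b9526265f46575b59cd6980045ac659e4562b7005262a091d0add98997879585e9d9e68c81003434346200782ba7d362ab2069691717171717b0c769aa692b2000345353b4d078782bf862e220539f53782ba0002b2062db9734e48be994208c8100f3686855d300c6c3d368ab7895554855ec58a498b500a1784878d74800e3b4b1c34858ac009e5868ae587855e39cbbdb85f391f1928b88e6e68c810025301945304a00c6a54aab3045462525464500b0c519f730254619194625ca99004a45a30eb64141f9410e0eaf410e0e1989f24a9585f490308e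c1005524555230553000243052305230305524522400305555244f182424184f1818184f2418524f18184f524f4f4f52184f5555243052305255183024003434293434484a48004a294a481c44441c4844444448441c4a4a29293429004a48483434441c291c1c1c29441c1c44293448341c2934294a4a484a00de6a5d5dd34ac1a7d100de5d9e5d6a4ab700c298a84dee4d4a00a96a4af79c998c4d7abb7ab67a00ae6a4d7ab8d1eeedd98991f1958788f18b8ec100366236626236362d7a7a002d1e1e2d6b6b6b2d1e1e1e1e2d6b7a6b1e1e1e6b6b7a7a6b6b7a002d3636623662627a2d2d1e2d7a6236366262362d7a00a7301010ab208e9bd310ab00d2300030a320c2cfc52dee001020eb0030e3c4d48c0000bb2de22d2de1002000fbbabb9b85dbf2f1e48bf4e68b8ec100002a1e52523376b3d12af6760076613333332ad2a81eaa61151515671567c8b1156767ac2a9e761ee1615252a02a1e001ee7936195dd8ae6338e8200d5467600e246c5b3b259ab46d2005669f569c7d2c576aa695956eb564696b499a60076a356e276599f006959afbadd9be586e5848ff58a94f28e8200f3616474b464999bd744ab00e7740044df74c7a4c774f7615454d70064f7a9b1cb4454bb619e54449f646100b8d1ae8fe5e7dada958b8496888e8200a1000727b427b0c9d31aed27aa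171a009417a4a4c737a1170717d7370796b4d0c31a00e037e20007ea1a3727ec9cddf9e5f3da84f0f5849488cdc00014147575147575b3a514de1428565637002337a4a837df6c5628285f6c009cd6235f23a328eb2837b76c5f23ec5f006c568697378ff5889423cdc000f3332633a003c6c3d700f62395131333a800a498a813df232600b82623b5cad6980326e013fa0300ea033323b8efd08f8ae7f2da95dd88e688cdc0001a244747241a00c99a44a2493149441a243100a4c731aa49442447472444c4b1001a31f80dad0d42b70d4242fb0d0d4231f3911af08b8496498dc20027494933272746004933334633463327333349004649274946431b1b4346434343461b43431b27271b431b1b1b43271b49274933334633271b464900265019195026191919261950315654565626312600315431545626313154310026562656505050195054195450195054195456562656315431312600ea111e31e2008ec3d301ba01aa1e1111a8318dd29d00aa111e31a23100d4c4d0c02e01ef00fa1e2ee12e2e01e3ba9db98af3e584f0dd8ae6f28dc2006a6a791f1f1f796a6a6a6a7961376137376137792e2e00796a6a6a1f2e1f1f1f2e1f2e1f6161372e00793761372e2e793761611f792e3737612e7900a7490049f86c8e9b9a79ba4cd2495c5cdf6cc2cfa85cdf000049b85c6c9fa999c04c4cef79b64c79b779006cafefeecf8a86f2da8f8b8896f2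8dc200b6250022b42599c9d725de059e053525f535c7d5c522f7000035a9121296a999a61222e022b63505f9120005ecd190ed8686e589f0e8dc96d8ccc100d50815089738c5b3d100de18b3282808a300b1d2cb28ee181500931518acc8a6a63815a328eb3800e1380818ecdcfb9b868393e4d8f5f4f183ccc1002957296b0060229bd722a26013747474131374a4b513df13223800575729a9a638386be022eb6029ea29386bb8006b60228693579587f49038ccc100ea5a57479757a5b39a77a200e1470077d647c4b0b547aa5a6767f40057d4c4d4c87767ac5aad6777e1575a00a0dc9db9f08993e4e487f490838d8000d5535366f800caa7b253ba43b3667366f5639ad59d00aa437343e07300e8c8a6c87363f800b663539f634366a0af90cf868397e4d8e88a96d88d800016161616686816c6b268ab685435541f002c77cfb577f72c353535776300a9d42c1f63ac549e54779f2c1f63e31f002c3589e51f92e8dc96638d800025535732533225320025575751251a1a25511a1a1a511a2525575757533200253232325353511a5151511a535151531a3232531a57535725573225001d474545471d4545451d45472828354b284b474b0047353535283547353547004b4b4b281d1d1d281d4528451d281d451d35284b4b28473535474b0048432626434800c3b232f6182618484818260098cb4ba1433218264b4332c8a600324bac40fa400cae0c400cb80c400c4b8397328ff58af1188cc000a11f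3200d332c1c3d102ed2fe100321fec0f8dd2c502b902320fa91f0fac9cd48c000fac02e22f1ff9002f2fe39cbbb9f089e589e4f5dcf1838cc000b6004b6ba05bc1a79a4eed4ef66b4b00a84b8d989d4eb97b6b5be04b5bd4a9d0c05b00e06bad004eb77b7b7bb8efd0edf0869789f0878a90d88cc0006c6c6c2f20202f20202f20202020207b6c6c7b6c6c7b6c6c6338383863632f7b382f7b006338383863632f7b002f7b2f6338383863632f7b202f7b00de2a1d0ae90099c9d13af63a9e1d2a2ab70ab1d5c700ee2a1d0a930a00f7c8b1cb0d3af8009e1d0dae0d0d3afb91aead81e79182d8e8dcd9ccce81005e6d5e2b2b3a2b6d3a3a006d7676225e5e5e2276767676222276222b2b2b2222767622223a006d5e5e6d3a2b2b3a3a6d226d3a6d5e5e2b2b3a6d3a0092007050ab60c59bb26da26de7507000a370b1a4cb6da1405060eb7060e3b4a6cb6000bb50eb006dae404040fbfafbdbcedb93828f858494ccce8100ea515e5ee271cab3a500ba5eaa5e51719400c4b09d6ea16e7100a25171e8caa6b26e41a341fa4100ea516e41affaddf9ce8393cd92dd849080cd82002121772a2a2a7721212121772a392a5f5f6e2a396e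6e00395f5f5f7721777777217721772a2a396e00395f6e5f396e39392a2a21396e5f5f6e6e3900921c0900f809cac6b239f60ce700091cdf2c9acfcb39f739092cb81c2c9fc8d6b2002cef39fa0c1c9f000c0cafafae8fcedbda828fe8e9d980cd8200a1720072e94fb0c9a542a26fe1725f5fec4fc9a4b55fb9000072935f4fac9cb1c36f6fa342ad6f42f942004fecdcfbf9818391cd9285dc94cccc8000b60b2b2ba01bb0c6d72bed00f60b000b941bc9b0c70ef73b2b1be0000be8cad0983b3bf80ead0e0ef93b1b00a0af90ad81e7dacdd8dde99080cc80006060602378782378782378782c2c2c7823237823237823236f60603b2c2c6f3b2c6f3b006f60603b2c2c6f3b006f3b3b6f60603b2c2c6f3b236f3b00511c513a002f7ac3d17aba2f11115c115c5c11d2a811b95c7a6f00511c1c9c992f2f7aef3afa6f51ae1c6f3aaf003a2f3a83911c92e8dcd96f8d82005d5d105d101010a7d35dba101d501d6e007b2e989d2eee7b1d50502e3b00c4d07b2e7bbb1dad506eae3b6e3bfb2e003b1de7936ed8dd84903b8e810000796d1b1b4f2d9b9a79ed2d002d394f4f1b79cfc52db9795b0f5b0f5b0fa9d40f0f5bbb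39ad6d6df9394f1baf392d006ddbda398f85e9941b8c800005650665590605c9b24ea2010a59705965060ad59d01b901050a06650506b499704e4eef0a9e7059b7700a05e301014e0086e500f0858ad900ce81001270700f6458151564120f58151564640f58701270580f1212151515121212150f0f0f0f7012701515640f645812580f70006464007058585870640008045c0a690a740874045c690a69746908740469745c5c5c74087404085c690a0a69045c0a690a08045c0874745c04690a0800040404000a08080a0007040904076471b39a4ded4d5a076407046404b0cb02a14d075a645a71099cd6090202bb04e209719f095a71b8024d020089da00e48784f100cd8200737306065b03096709035b676709095b0603737306675b037367066773097367035b5b5b737306096709065b0303675b060009090006030303060900161416141416101416101010665910711471166616591014596610166616711471591410665910711471166616591014595959716600710066716600115a6565171772721313115a1317131717131117131111117272135a11651765175a1311651717115a6572721311135a6572005a5a5a006572726500077568750b680575685d5d5d5d05070775750b0b68685d05055d070b0b6807757568055d5d05070775750b0b68685d05050505070b0007000b070b00660858720b580b9bd700ba000866030b08037298b54cee4c660803086658cab103004ca372b6580be103720ba04c00000083f200d88b88e600cc80004240410201004142400201000201004240414241400102004240410201004142400201004241404142404241400201000102000201000102000000004e4d4c0e0c0d0e0d0c4d4e4c0e0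c0d4e4d4c0d0e0c4e4d4c4e4d4c0e0c0d0e0d0c4d4e4c0d0e0c0e0d0c0d0e0c0d0e0c4e4d4c4d4e4c4e4d4c000000000000000000000000000000000000000000000000000000000000000000000000000000000000000000000000000000000000000000000000000000
def repDigits : Nat := 0xc530ca0c710d0d9c5ac5b10ec650cd0c40df11b0ee0e51310f11330f7

def image (t : Nat) (x : Fin 5) : Fin 5 := Fin.ofNat 5 (digit permDigits 3 (5 * (t - 1) + x))

theorem image_mulLabel : ∀ i j : Fin 60, ∀ x,
    image (mulLabel (i + 1) (j + 1)) x = image (i + 1) (image (j + 1) x) := by decide +kernel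

theorem image_invLabel : ∀ i : Fin 60, ∀ x, image (invLabel (i + 1)) (image (i + 1) x) = x ∧
    image (i + 1) (image (invLabel (i + 1)) x) = x := by decide +kernel

theorem image_injective : ∀ i j : Fin 60, (∀ x, image (i + 1) x = image (j + 1) x) → i = j := by
  decide +kernel

theorem label_bounds : ∀ i j : Fin 60,
    (1 ≤ mulLabel (i + 1) (j + 1) ∧ mulLabel (i + 1) (j + 1) ≤ 60) ∧
    (1 ≤ invLabel (i + 1) ∧ invLabel (i + 1) ≤ 60) := by decide +kernel

def permOf (i : Fin 60) : Equiv.Perm (Fin 5) where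
  toFun := image (i + 1)
  invFun := image (invLabel (i + 1))
  left_inv x := (image_invLabel i x).1
  right_inv x := (image_invLabel i x).2

theorem sign_permOf : ∀ i, Equiv.Perm.sign (permOf i) = 1 := by decide +kernel

def elem (i : Fin 60) : A₅ := ⟨permOf i, Equiv.Perm.mem_alternatingGroup.2 (sign_permOf i)⟩

theorem elem_injective : Function.Injective elem := fun i j h =>
  image_injective i j fun x => congrArg (fun g : A₅ => (g : Equiv.Perm (Fin 5)) x) h

theorem card_A5 : Fintype.card A₅ = 60 := by
  have h := two_mul_card_alternatingGroup (α := Fin 5)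
  rw [Fintype.card_perm, Fintype.card_fin] at h
  have : Nat.factorial 5 = 120 := rfl
  omega

def elemEquiv : Fin 60 ≃ A₅ := Equiv.ofBijective elem
  ((Fintype.bijective_iff_injective_and_card elem).2 ⟨elem_injective, by rw [card_A5]; rfl⟩)

/-- The label of a group element. -/
def lab (g : A₅) : Nat := elemEquiv.symm g + 1

theorem lab_bounds (g : A₅) : 1 ≤ lab g ∧ lab g ≤ 60 := by
  have := (elemEquiv.symm g).isLt
  unfold lab; omega

theorem lab_injective : Function.Injective lab := fun g h e =>
  elemEquiv.symm.injective (Fin.ext (by unfold lab at e; omega))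

theorem elem_lab_sub (g : A₅) : elem (elemEquiv.symm g) = g := elemEquiv.apply_symm_apply g

theorem lab_eq {g : A₅} {t : Nat} (h : 1 ≤ t ∧ t ≤ 60)
    (e : ∀ x, image t x = (g : Equiv.Perm (Fin 5)) x) : lab g = t := by
  have : elemEquiv ⟨t - 1, by omega⟩ = g := by
    refine Subtype.ext (Equiv.ext fun x => ?_)
    have h' : t - 1 + 1 = t := by omega
    rw [← e x]
    change image (t - 1 + 1) x = _
    rw [h']
  rw [lab, ← this, Equiv.symm_apply_apply]
  change t - 1 + 1 = t
  omega

theorem image_lab (g : A₅) (x : Fin 5) : image (lab g) x = (g : Equiv.Perm (Fin 5)) x := by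
  conv_rhs => rw [← elem_lab_sub g]
  rfl

theorem lab_mul (g h : A₅) : lab (g * h) = mulLabel (lab g) (lab h) := by
  refine lab_eq (label_bounds (elemEquiv.symm g) (elemEquiv.symm h)).1 fun x => ?_
  rw [lab, lab, image_mulLabel]
  change image (lab g) (image (lab h) x) = _
  rw [image_lab, image_lab]; rfl

theorem lab_one : lab 1 = 1 :=
  lab_eq ⟨le_rfl, by omega⟩ (by decide +kernel)

theorem lab_inv (g : A₅) : lab g⁻¹ = invLabel (lab g) := by
  refine lab_eq (label_bounds (elemEquiv.symm g) (elemEquiv.symm g)).2 fun x => ?_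
  apply (g : Equiv.Perm (Fin 5)).injective
  rw [← image_lab, Subgroup.coe_inv, ← Equiv.Perm.mul_apply, mul_inv_cancel]
  exact (image_invLabel (elemEquiv.symm g) x).2

theorem exists_lab {t : Nat} (h : 1 ≤ t ∧ t ≤ 60) : ∃ g, lab g = t := by
  refine ⟨elemEquiv ⟨t - 1, by omega⟩, ?_⟩
  rw [lab, Equiv.symm_apply_apply]
  change t - 1 + 1 = t
  omega

theorem ev_eq {α : Type} (n : Nat) (f : Nat → α) : ev n f = f n := (rfl)

theorem orB_eq_true {a b : Bool} : orB a b = true ↔ a = true ∨ b = true := by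
  cases a <;> simp [orB]

theorem exists_bit : ∀ i : Fin 60, ∃ k : Fin 60, 2 ^ k.val % 61 = i.val + 1 := by decide +kernel

def pt (g : A₅) : Nat := (exists_bit (elemEquiv.symm g)).choose

theorem pt_lt (g : A₅) : pt g < 60 := (exists_bit (elemEquiv.symm g)).choose.isLt

theorem two_pow_pt (g : A₅) : 2 ^ pt g % 61 = lab g := (exists_bit (elemEquiv.symm g)).choose_spec

/-- `g` belongs to the set encoded by `m`. -/
def Mem (m : Nat) (g : A₅) : Prop := m.testBit (pt g) = true

theorem allB_fuel (f : Nat → Bool) (n : Nat) : ∀ m,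
    Nat.rec (motive := fun _ => Nat → Bool) (fun _ => false)
    (fun _ ih m => Nat.rec true (fun k _ =>
      ev (Nat.gcd (Nat.add k 1) 1152921504606846976) fun b =>
        Bool.rec false (ih (Nat.xor (Nat.add k 1) b)) (f (Nat.mod b 61))) m) n m = true →
    ∀ k < 60, m.testBit k = true → f (2 ^ k % 61) = true := by
  induction n with
  | zero => intro m h; cases h
  | succ n ih =>
    intro m h k hk hb
    cases m with
    | zero => simp at hb
    | succ m =>
      obtain ⟨j, hj, e⟩ := (Nat.dvd_prime_pow Nat.prime_two (i := Nat.gcd (m + 1) (2 ^ 60))).1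
        (Nat.gcd_dvd_right _ _)
      have h' : Bool.rec false (Nat.rec (motive := fun _ => Nat → Bool) (fun _ => false)
        (fun _ ih m => Nat.rec true (fun k _ =>
        ev (Nat.gcd (Nat.add k 1) 1152921504606846976) fun b =>
        Bool.rec false (ih (Nat.xor (Nat.add k 1) b)) (f (Nat.mod b 61))) m) n
          (Nat.xor (m + 1) (Nat.gcd (m + 1) (2 ^ 60)))) (f (Nat.gcd (m + 1) (2 ^ 60) % 61)) = true := h
      rw [e] at h'
      rcases hf : f (2 ^ j % 61) with _ | _
      · rw [hf] at h'; cases h'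
      · rw [hf] at h'
        by_cases hjk : k = j
        · rw [hjk, hf]
        · refine ih _ h' k hk ?_
          have : Nat.xor (m + 1) (2 ^ j) = (m + 1) ^^^ 2 ^ j := rfl
          rw [this, Nat.testBit_xor, hb, Nat.testBit_two_pow_of_ne (Ne.symm hjk)]; rfl

theorem allB_mem {f : Nat → Bool} {m : Nat} (h : allB f m = true) {g : A₅} (hg : Mem m g) :
    f (lab g) = true := by
  rw [← two_pow_pt]; exact allB_fuel f 61 m h _ (pt_lt g) hg

def andB (a b : Bool) : Bool := Bool.rec false b a

theorem andB_eq_true {a b : Bool} : andB a b = true ↔ a = true ∧ b = true := by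
  cases a <;> simp [andB]

/-- All labels satisfy `f`. -/
def allLabels (f : Nat → Bool) : Bool :=
  Nat.rec true (fun k ih => ev (Nat.add k 1) fun t => andB (f t) ih) 60

theorem allLabels_lab {f : Nat → Bool} (h : allLabels f = true) (g : A₅) : f (lab g) = true := by
  have key : ∀ n, Nat.rec (motive := fun _ => Bool) true
      (fun k ih => ev (Nat.add k 1) fun t => andB (f t) ih) n = true →
      ∀ t, 1 ≤ t → t ≤ n → f t = true := by
    intro n
    induction n with
    | zero => intro _ t h1 h2; omega
    | succ n ih =>
      intro h t h1 h2
      have h' := andB_eq_true.1 h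
      rcases Nat.lt_or_ge n t with hn | hn
      · rw [show t = n + 1 by omega]; exact h'.1
      · exact ih h'.2 t h1 hn
  exact key 60 h _ (lab_bounds g).1 (lab_bounds g).2

def rowsValid : Bool := allLabels fun j => ev (R j) fun r => allLabels fun i =>
  andB (Nat.beq (r ◃ c0 i) (c1 (mulLabel i j))) (Nat.beq (r ◃ c1 i) (c2 (mulLabel i j)))

def invValid : Bool := allLabels fun i =>
  andB (Nat.beq (invTable ◃ c0 i) (c1 (invLabel i)))
    (andB (Nat.beq (invTable ◃ c1 i) (c2 (invLabel i))) (Nat.beq (ix (c2 i)) i))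

def testsValid : Bool := allLabels fun j => ev (T j) fun t => allLabels fun i =>
  allB (fun x => Nat.beq (mulLabel (mulLabel x (invLabel j)) (invLabel x)) i) (t ◃ c2 i)

theorem rowsValid_eq : rowsValid = true := by decide +kernel
theorem invValid_eq : invValid = true := by decide +kernel
theorem testsValid_eq : testsValid = true := by decide +kernel

theorem R_c0 (a g : A₅) : R (lab a) ◃ c0 (lab g) = c1 (lab (g * a)) := by
  have h := allLabels_lab (allLabels_lab rowsValid_eq a) g
  rw [lab_mul]; exact Nat.eq_of_beq_eq_true (andB_eq_true.1 h).1

theorem R_c1 (a g : A₅) : R (lab a) ◃ c1 (lab g) = c2 (lab (g * a)) := by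
  have h := allLabels_lab (allLabels_lab rowsValid_eq a) g
  rw [lab_mul]; exact Nat.eq_of_beq_eq_true (andB_eq_true.1 h).2

theorem inv_c0 (g : A₅) : invTable ◃ c0 (lab g) = c1 (lab g⁻¹) := by
  have h := allLabels_lab invValid_eq g
  rw [lab_inv]; exact Nat.eq_of_beq_eq_true (andB_eq_true.1 h).1

theorem inv_c1 (g : A₅) : invTable ◃ c1 (lab g) = c2 (lab g⁻¹) := by
  have h := allLabels_lab invValid_eq g
  rw [lab_inv]; exact Nat.eq_of_beq_eq_true (andB_eq_true.1 (andB_eq_true.1 h).2).1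

theorem ix_c2 (g : A₅) : ix (c2 (lab g)) = lab g :=
  Nat.eq_of_beq_eq_true (andB_eq_true.1 (andB_eq_true.1 (allLabels_lab invValid_eq g)).2).2

theorem T_c2 {a w q : A₅} (h : Mem (T (lab a) ◃ c2 (lab w)) q) : q * a⁻¹ * q⁻¹ = w := by
  have h := allB_mem (allLabels_lab (allLabels_lab testsValid_eq a) w) h
  apply lab_injective
  rw [lab_mul, lab_mul, lab_inv, lab_inv]; exact Nat.eq_of_beq_eq_true h

theorem c2_injective {g h : A₅} (e : c2 (lab g) = c2 (lab h)) : g = h :=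
  lab_injective (by rw [← ix_c2 g, e, ix_c2])

theorem P_lab (a b : A₅) : P (lab a) (lab b) = R (lab (b * a)) := by
  rw [P, ev_eq, R_c1, ix_c2]

theorem Q_lab (a b : A₅) : Q (lab a) (lab b) = R (lab (b * a)⁻¹) := by
  rw [Q, ev_eq, R_c1, ix_c2, iv, inv_c1, ix_c2]

theorem T2_lab (a b : A₅) : T2 (lab a) (lab b) = T (lab (b * a)) := by
  rw [T2, ev_eq, R_c1, ix_c2]

theorem T3_lab (a b c : A₅) : T3 (lab a) (lab b) (lab c) = T (lab (c * b * a)) := by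
  rw [T3, ev_eq, R_c0, R_c1, ix_c2]

theorem T4_lab (a b c d : A₅) :
    T4 (lab a) (lab b) (lab c) (lab d) = T (lab (d * c * (b * a))) := by
  rw [T4, ev_eq, P_lab, R_c0, R_c1, ix_c2]

theorem step_lab (p q : A₅) : step (lab p) (lab q) = lab (q⁻¹ * p) := by
  rw [step, inv_c0, R_c1, ix_c2]

/-- `q` is obtained from `g` by a product that is rewritable,
where `L` is the multiset of inverses of the letters of a word for `g`. -/
def Bad (g : A₅) (L : Multiset A₅) (q : A₅) : Prop :=
  ∃ l m : List A₅, (l : Multiset A₅) + m = L ∧ m ≠ [] ∧ q * m.prod⁻¹ * q⁻¹ = g * l.prod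

def AllBad (S : Nat) (g : A₅) (L : Multiset A₅) : Prop := ∀ q, Mem S q → Bad g L q

def IsTest (t : Nat) (s : Multiset A₅) : Prop := ∃ m : List A₅, (m : Multiset A₅) = s ∧ t = T (lab m.prod)

def IsRow (r : Nat) (s : Multiset A₅) : Prop := ∃ l : List A₅, (l : Multiset A₅) = s ∧ r = R (lab l.prod)

/-- `v` is the code of `g` times a product of the elements of `s`. -/
def IsVal (c : Nat → Nat) (g : A₅) (v : Nat) (s : Multiset A₅) : Prop :=
  ∃ l : List A₅, (l : Multiset A₅) = s ∧ v = c (lab (g * l.prod))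

theorem AllBad.lor {S S' : Nat} {g : A₅} {L : Multiset A₅} (h : AllBad S g L) (h' : AllBad S' g L) :
    AllBad (Nat.lor S S') g L := by
  intro q hq
  have : (S ||| S').testBit (pt q) = true := hq
  rw [Nat.testBit_or, Bool.or_eq_true] at this
  exact this.elim (h q) (h' q)

theorem AllBad.mod {t v : Nat} {g : A₅} {s u L : Multiset A₅} (ht : IsTest t s)
    (hv : IsVal c2 g v u) (hL : u + s = L) (hs : s ≠ 0) : AllBad (t ◃ v) g L := by
  obtain ⟨m, rfl, rfl⟩ := ht
  obtain ⟨l, rfl, rfl⟩ := hv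
  exact fun q hq => ⟨l, m, hL, by simpa using hs, T_c2 hq⟩

theorem IsTest.one (a : A₅) : IsTest (T (lab a)) {a} := ⟨[a], rfl, by simp⟩
theorem IsTest.two (a b : A₅) : IsTest (T2 (lab a) (lab b)) ({b} + {a}) :=
  ⟨[b, a], rfl, by simp [T2_lab]⟩
theorem IsTest.three (a b c : A₅) : IsTest (T3 (lab a) (lab b) (lab c)) ({c} + {b} + {a}) :=
  ⟨[c, b, a], rfl, by simp [T3_lab, mul_assoc]⟩
theorem IsTest.four (a b c d : A₅) :
    IsTest (T4 (lab a) (lab b) (lab c) (lab d)) ({d} + {c} + {b} + {a}) :=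
  ⟨[d, c, b, a], rfl, by simp [T4_lab, mul_assoc]⟩

theorem IsRow.one (a : A₅) : IsRow (R (lab a)) {a} := ⟨[a], rfl, by simp⟩
theorem IsRow.two (a b : A₅) : IsRow (P (lab a) (lab b)) ({b} + {a}) :=
  ⟨[b, a], rfl, by simp [P_lab]⟩

theorem IsVal.base (c : Nat → Nat) (g : A₅) : IsVal c g (c (lab g)) 0 := ⟨[], rfl, by simp⟩
theorem IsVal.mod₀ {r v : Nat} {g : A₅} {s u : Multiset A₅} (hr : IsRow r s) (hv : IsVal c0 g v u) :
    IsVal c1 g (r ◃ v) (u + s) := by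
  obtain ⟨m, rfl, rfl⟩ := hr
  obtain ⟨l, rfl, rfl⟩ := hv
  exact ⟨l ++ m, rfl, by rw [R_c0, List.prod_append, mul_assoc]⟩
theorem IsVal.mod₁ {r v : Nat} {g : A₅} {s u : Multiset A₅} (hr : IsRow r s) (hv : IsVal c1 g v u) :
    IsVal c2 g (r ◃ v) (u + s) := by
  obtain ⟨m, rfl, rfl⟩ := hr
  obtain ⟨l, rfl, rfl⟩ := hv
  exact ⟨l ++ m, rfl, by rw [R_c1, List.prod_append, mul_assoc]⟩

section
attribute [local irreducible] c0 c1 c2 R T T2 T3 T4 P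

theorem allBad_F2 (x y w : A₅) : AllBad (F2 (lab x) (lab y) (lab w)) w ({x} + {y}) := by
  simp only [F2, lor3]
  repeat' apply AllBad.lor
  all_goals
    refine AllBad.mod (by first | apply IsTest.one | apply IsTest.two)
      (by first | exact IsVal.mod₁ (IsRow.one _) (IsVal.base _ _) | exact IsVal.base _ _) (by abel) (by simp)

theorem allBad_F3 (x y z w : A₅) :
    AllBad (F3 (lab x) (lab y) (lab z) (lab w)) w ({x} + {y} + {z}) := by
  simp only [F3, F3one, A2, lor3]
  repeat' apply AllBad.lor
  all_goals
    refine AllBad.mod (by first | apply IsTest.one | apply IsTest.two | apply IsTest.three)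
      (by first
        | exact IsVal.mod₁ (IsRow.one _) (IsVal.base _ _)
        | exact IsVal.mod₁ (IsRow.two _ _) (IsVal.base _ _)
        | exact IsVal.base _ _) (by abel) (by simp)

theorem allBad_F4 (x y z d w : A₅) :
    AllBad (F4 (lab x) (lab y) (lab z) (lab d) (lab w)) w ({x} + {y} + {z} + {d}) := by
  simp only [F4, F4one, F4pair, A3, A2, lor3]
  repeat' apply AllBad.lor
  all_goals
    refine AllBad.mod (by
      first | apply IsTest.one | apply IsTest.two | apply IsTest.three | apply IsTest.four)
      (by first
        | exact IsVal.mod₁ (IsRow.one _) (IsVal.base _ _)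
        | exact IsVal.mod₁ (IsRow.two _ _) (IsVal.base _ _)
        | exact IsVal.mod₁ (IsRow.two _ _) (IsVal.mod₀ (IsRow.one _) (IsVal.base _ _))
        | exact IsVal.base _ _) (by abel) (by simp)

theorem allBad_F5a (x y z d e w : A₅) :
    AllBad (F5a (lab x) (lab y) (lab z) (lab d) (lab e) (c0 (lab w))) w ({x} + {y} + {z} + {d} + {e}) := by
  simp only [F5a, F5aone, A4, A22, A2, lor3]
  repeat' apply AllBad.lor
  all_goals
    exact AllBad.mod (IsTest.one _)
      (IsVal.mod₁ (IsRow.two _ _) (IsVal.mod₀ (IsRow.two _ _) (IsVal.base _ _))) (by abel) (by simp)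

theorem allBad_F5b (x y z d e w : A₅) :
    AllBad (F5b (lab x) (lab y) (lab z) (lab d) (lab e) (c0 (lab w))) w ({x} + {y} + {z} + {d} + {e}) := by
  simp only [F5b, F5bone, A3', A2, lor3]
  repeat' apply AllBad.lor
  all_goals
    exact AllBad.mod (IsTest.one _)
      (IsVal.mod₁ (IsRow.two _ _) (IsVal.mod₀ (IsRow.two _ _) (IsVal.base _ _))) (by abel) (by simp)

theorem allBad_F5c (x y z d e w : A₅) :
    AllBad (F5c (lab x) (lab y) (lab z) (lab d) (lab e) (c0 (lab w))) w ({x} + {y} + {z} + {d} + {e}) := by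
  simp only [F5c, F5cone, F5v, F5w, A3, A2, lor3]
  repeat' apply AllBad.lor
  all_goals
    exact AllBad.mod (IsTest.two _ _)
      (IsVal.mod₁ (IsRow.two _ _) (IsVal.mod₀ (IsRow.one _) (IsVal.base _ _))) (by abel) (by simp)

end

/-- No rearrangement of the word `L` has the same value. -/
def Rigid {G : Type*} [Group G] (L : List G) : Prop :=
  L.Nodup ∧ ∀ l : List G, l.Perm L → l.prod = L.prod → l = L

/-- `L` is a relator, and all rearrangements that are relators are rotations. -/
def CycRigid {G : Type*} [Group G] (L : List G) : Prop :=
  L.Nodup ∧ L.prod = 1 ∧ ∀ l : List G, l.Perm L → l.prod = 1 → l.IsRotated L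

section
variable {G : Type*} [Group G]

theorem Rigid.not_commute {A B : List G} {a b : G} (h : Rigid (A ++ a :: b :: B))
    (hab : a * b = b * a) : False := by
  have e := h.2 (A ++ b :: a :: B) ((List.Perm.swap a b B).append_left A) (by
    simp only [List.prod_append, List.prod_cons, ← mul_assoc]
    rw [mul_assoc _ a b, hab, ← mul_assoc])
  have hn := (List.nodup_append.1 h.1).2.1
  simp only [List.append_cancel_left_eq, List.cons.injEq] at e
  simp [e.1] at hn

theorem prod_eq_of_rotate {A B : List G} {y : G} (h : (A ++ y :: B).prod = 1) :
    (B ++ A).prod = y⁻¹ := by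
  rw [List.prod_append, List.prod_cons] at h
  rw [List.prod_append, eq_inv_iff_mul_eq_one]
  calc B.prod * A.prod * y = (A.prod * y)⁻¹ * (A.prod * (y * B.prod)) * (A.prod * y) := by group
    _ = 1 := by rw [h]; group

theorem Rigid.cycRigid {L : List G} (h : Rigid L) (hL : Even L.length) :
    CycRigid (L.prod⁻¹ :: L) := by
  classical
  refine ⟨List.nodup_cons.2 ⟨fun hy => ?_, h.1⟩, by simp, fun l hl hp => ?_⟩
  · obtain ⟨A, B, e⟩ := List.append_of_mem hy
    have hp : (B ++ L.prod⁻¹ :: A).prod = L.prod := by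
      have h1 : (A ++ L.prod⁻¹ :: (B ++ [L.prod⁻¹])).prod = 1 := by
        rw [← List.cons_append, ← List.append_assoc, ← e]; simp
      have := prod_eq_of_rotate h1
      rw [inv_inv] at this
      simpa using this
    have e' := h.2 (B ++ L.prod⁻¹ :: A) (by
      conv_rhs => rw [e]
      exact List.perm_append_comm.trans (by simpa using List.perm_middle.symm)) hp
    have hn := h.1
    rw [e] at hn
    have hA : L.prod⁻¹ ∉ A := fun ha => by
      have := List.disjoint_of_nodup_append hn ha; simp at this
    have hn' := h.1
    rw [← e'] at hn'
    have hB : L.prod⁻¹ ∉ B := fun ha => by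
      have := List.disjoint_of_nodup_append hn' ha; simp at this
    have hi := congrArg (List.idxOf L.prod⁻¹) (e'.trans e)
    rw [List.idxOf_append_of_notMem hA, List.idxOf_append_of_notMem hB] at hi
    have hlen := congrArg List.length e
    simp at hi hlen
    rw [hi] at hlen
    rw [hlen, ← add_assoc] at hL
    exact (Nat.not_even_iff_odd.2 ⟨A.length, by ring⟩) hL
  · obtain ⟨A, B, rfl⟩ := List.append_of_mem (hl.mem_iff.2 List.mem_cons_self)
    have h1 := prod_eq_of_rotate hp
    rw [inv_inv] at h1
    have hp' : (B ++ A).Perm L := List.perm_append_comm.trans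
      (List.Perm.cons_inv (List.perm_middle.symm.trans hl))
    have h2 := h.2 (B ++ A) hp' h1
    have h3 : (A ++ L.prod⁻¹ :: B).IsRotated (L.prod⁻¹ :: B ++ A) := List.isRotated_append
    rwa [List.cons_append, h2] at h3

theorem CycRigid.rotated {L L' : List G} (h : CycRigid L) (e : L.IsRotated L')  : CycRigid L' := by
  refine ⟨e.nodup_iff.1 h.1, ?_, fun l hl hp => (h.2.2 l (hl.trans e.perm.symm) hp).trans e⟩
  obtain ⟨n, hn, rfl⟩ := List.isRotated_iff_mod.1 e
  rw [List.rotate_eq_drop_append_take hn, List.prod_append]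
  have := h.2.1
  rw [← List.take_append_drop n L, List.prod_append] at this
  exact mul_eq_one_comm.1 this

theorem CycRigid.rigid {L : List G} {y : G} (h : CycRigid (L ++ [y])) : Rigid L := by
  refine ⟨(List.nodup_append.1 h.1).1, fun l hl hp => ?_⟩
  have hr := h.2.2 (l ++ [y]) (hl.append_right _) (by
    rw [List.prod_append, hp, ← List.prod_append, h.2.1])
  obtain ⟨n, hn, e⟩ := List.isRotated_iff_mod.1 hr
  rw [List.rotate_eq_drop_append_take hn] at e
  have e' := List.take_append_drop n (l ++ [y])
  set u := (l ++ [y]).take n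
  set v := (l ++ [y]).drop n
  rcases List.eq_nil_or_concat u with hu | ⟨u', a, hu⟩
  · rw [hu] at e e'
    simp only [List.nil_append, List.append_nil] at e e'
    exact List.append_cancel_right (e'.symm.trans e)
  rcases List.eq_nil_or_concat v with hv | ⟨v', b, hv⟩
  · rw [hv] at e e'
    simp only [List.nil_append, List.append_nil] at e e'
    exact List.append_cancel_right (e'.symm.trans e)
  exfalso
  rw [hu, hv] at e e'
  have h1 := (List.append_inj' (by simpa [← List.append_assoc] using e :
    (v' ++ [b] ++ u') ++ [a] = L ++ [y]) rfl).2
  have h2 := (List.append_inj' (by simpa [← List.append_assoc] using e' :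
    (u' ++ [a] ++ v') ++ [b] = l ++ [y]) rfl).2
  have hn := h.1
  rw [← e, (List.cons.inj h1).1, (List.cons.inj h2).1] at hn
  have := List.disjoint_of_nodup_append hn
  simp at this

theorem CycRigid.map {L : List G} (h : CycRigid L) (φ : MulAut G) : CycRigid (L.map φ) := by
  refine ⟨h.1.map φ.injective, by rw [← map_list_prod, h.2.1, map_one], fun l hl hp => ?_⟩
  have h1 : (L.map φ).map φ.symm = L := by simp
  have h2 : (l.map φ.symm).map φ = l := by simp
  have := h.2.2 (l.map φ.symm) (by rw [← h1]; exact hl.map _) (by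
    rw [← map_list_prod, hp, map_one])
  rw [← h2]; exact this.map φ

theorem CycRigid.inv_reverse {L : List G} (h : CycRigid L) :
    CycRigid (L.map (·⁻¹)).reverse := by
  have inv (l : List G) : ((l.map (·⁻¹)).reverse.map (·⁻¹)).reverse = l := by simp
  refine ⟨List.nodup_reverse.2 (h.1.map inv_injective), by
    rw [← List.prod_inv_reverse, h.2.1, inv_one], fun l hl hp => ?_⟩
  have := h.2.2 (l.map (·⁻¹)).reverse (by
    conv_rhs => rw [← inv L]
    exact (List.reverse_perm _).trans ((hl.map _).trans (List.reverse_perm _).symm)) (by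
    rw [← List.prod_inv_reverse, hp, inv_one])
  rw [← inv l]
  exact (this.map _).reverse

end

theorem Rigid.not_bad {A B C : List A₅} (h : Rigid (A ++ B ++ C)) (hB : B ≠ []) :
    ¬ Bad A.prod (A.map (·⁻¹) : List A₅) (A ++ B).prod := by
  rintro ⟨l, m, hlm, hm, e⟩
  have hperm : (l ++ m).Perm (A.map (·⁻¹)) := Multiset.coe_eq_coe.1 hlm
  set u := (l.map (·⁻¹)).reverse with hu
  set v := (m.map (·⁻¹)).reverse with hv
  have huv : (u ++ v).Perm A := by
    have h1 := hperm.map (·⁻¹)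
    simp only [List.map_append, List.map_map, inv_comp_inv, List.map_id] at h1
    exact ((List.reverse_perm _).append (List.reverse_perm _)).trans h1
  have hpr : (u ++ B ++ v ++ C).prod = (A ++ B ++ C).prod := by
    have h1 : u.prod = l.prod⁻¹ := (List.prod_inv_reverse l).symm
    have h2 : v.prod = m.prod⁻¹ := (List.prod_inv_reverse m).symm
    simp only [List.prod_append] at e ⊢
    rw [h1, h2, mul_right_cancel_iff]
    have : m.prod⁻¹ = (A.prod * B.prod)⁻¹ * (A.prod * l.prod) * (A.prod * B.prod) := by
      rw [← e]; group
    rw [this]; group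
  have heq := h.2 (u ++ B ++ v ++ C) (by
    refine List.Perm.append_right C ?_
    rw [List.append_assoc]
    exact (List.perm_append_comm.append_left u).trans
      (by rw [← List.append_assoc]; exact huv.append_right B)) hpr
  have heq' := List.append_cancel_right heq
  have hvn : v ≠ [] := by simpa [hv] using hm
  have hlast := congrArg List.getLast? heq'
  rw [List.getLast?_append_of_ne_nil _ hvn, List.getLast?_append_of_ne_nil _ hB,
    List.getLast?_eq_some_getLast hvn, List.getLast?_eq_some_getLast hB, Option.some_inj] at hlast
  have hd := List.disjoint_of_nodup_append (List.nodup_append.1 h.1).1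
  exact hd (huv.mem_iff.1 (List.mem_append_right u (List.getLast_mem hvn)))
    (hlast ▸ List.getLast_mem hB)

theorem Bad.split {g q : A₅} {D : List A₅} {s : Multiset A₅} (hD : D ≠ [])
    (h : Bad g (s + {D.prod}) q) : Bad g (s + D) q := by
  obtain ⟨l, m, hs, hm, e⟩ := h
  have hmem : D.prod ∈ (l : Multiset A₅) + m := by rw [hs]; simp
  rcases Multiset.mem_add.1 hmem with hl | hl
  · obtain ⟨A, B, rfl⟩ := List.append_of_mem (Multiset.mem_coe.1 hl)
    refine ⟨A ++ D ++ B, m, ?_, hm, by rw [e]; simp⟩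
    have : ((A ++ B : List A₅) : Multiset A₅) + m = s := by
      rw [← add_left_inj {D.prod}, ← hs]
      simp only [← Multiset.coe_add, ← Multiset.cons_coe, ← Multiset.singleton_add]; abel
    rw [← this]
    simp only [← Multiset.coe_add]; abel
  · obtain ⟨A, B, rfl⟩ := List.append_of_mem (Multiset.mem_coe.1 hl)
    refine ⟨l, A ++ D ++ B, ?_, by simp [hD], by rw [← e]; simp [mul_assoc]⟩
    have : (l : Multiset A₅) + (A ++ B : List A₅) = s := by
      rw [← add_left_inj {D.prod}, ← hs]
      simp only [← Multiset.coe_add, ← Multiset.cons_coe, ← Multiset.singleton_add]; abel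
    rw [← this]
    simp only [← Multiset.coe_add]; abel

section
attribute [local irreducible] R c0 c1 c2

theorem halves_eq {a b c d e f g h p : A₅}
    (H : halves (lab a⁻¹) (lab b⁻¹) (lab c⁻¹) (lab d⁻¹) (lab e⁻¹) (lab f⁻¹) (lab g⁻¹) (lab h⁻¹)
      (lab p) = true) : a * b * c * d * e * f * g * h = p := by
  rw [halves, Q_lab, Q_lab, P_lab, P_lab] at H
  have H := Nat.eq_of_beq_eq_true H
  rw [R_c0] at H
  rw [show c0 1 = c0 (lab 1) by rw [lab_one], R_c0, R_c1, R_c1] at H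
  have H := c2_injective H
  simp only [mul_inv_rev, inv_inv, one_mul] at H
  calc _ = a * b * (c * d) * (e * f * (g * h)) := by simp only [mul_assoc]
    _ = p := by rw [H]; simp only [mul_assoc, inv_mul_cancel_left, inv_mul_cancel, mul_one]

/-- The index lists of the rearrangements in `wordTable`. -/
def wordIndices : List (List (Fin 8)) :=
  (wordTable fun a b c d e f g h : Fin 8 => [a, b, c, d, e, f, g, h]).map
    fun w => w 0 1 2 3 4 5 6 7

theorem wordIndices_valid :
    ∀ l ∈ wordIndices, l.isPerm [0, 1, 2, 3, 4, 5, 6, 7] = true ∧ l ≠ [0, 1, 2, 3, 4, 5, 6, 7] := by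
  decide +kernel

theorem wordTable_eq {α β : Type} (H : α → α → α → α → α → α → α → α → β) :
    wordTable H = wordIndices.map fun l a b c d e f g h =>
      let x (i : Nat) : α := ![a, b, c, d, e, f, g, h] (l.getD i 0)
      H (x 0) (x 1) (x 2) (x 3) (x 4) (x 5) (x 6) (x 7) := (rfl)

theorem vec_eta {α : Type} (x : Fin 8 → α) : ![x 0, x 1, x 2, x 3, x 4, x 5, x 6, x 7] = x := by
  ext i; fin_cases i <;> rfl

theorem exists_of_anyOf {α : Type} (f : α → Bool) (l : List α)
    (H : anyOf f l = true) :
    ∃ w ∈ l, f w = true := by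
  induction l with
  | nil => cases H
  | cons w l ih =>
    rcases hw : f w with _ | _
    · have H' : Bool.rec (motive := fun _ => Bool) (anyOf f l) true (f w) = true := H
      rw [hw] at H'
      obtain ⟨w', h1, h2⟩ := ih H'
      exact ⟨w', List.mem_cons_of_mem _ h1, h2⟩
    · exact ⟨w, List.mem_cons_self, hw⟩

theorem exists_of_someWord {a b c d e f g h p : Nat} (H : someWord a b c d e f g h p = true) :
    ∃ w ∈ wordTable halves, w a b c d e f g h p = true := by
  rw [someWord] at H
  exact exists_of_anyOf _ _ H

theorem Rigid.someWord {x : Fin 8 → A₅} (h : Rigid (List.ofFn x))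
    (H : someWord (lab (x 0)⁻¹) (lab (x 1)⁻¹) (lab (x 2)⁻¹) (lab (x 3)⁻¹) (lab (x 4)⁻¹)
      (lab (x 5)⁻¹) (lab (x 6)⁻¹) (lab (x 7)⁻¹) (lab (List.ofFn x).prod) = true) : False := by
  obtain ⟨w, hw, hp⟩ := exists_of_someWord H
  rw [wordTable_eq, List.mem_map] at hw
  obtain ⟨l, hl, rfl⟩ := hw
  obtain ⟨hperm, hne⟩ := wordIndices_valid l hl
  rw [List.isPerm_iff] at hperm
  simp only [vec_eta fun i => lab (x i)⁻¹] at hp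
  obtain ⟨a, b, c, d, e, f, g, h', rfl⟩ : ∃ a b c d e f g h, l = [a, b, c, d, e, f, g, h] := by
    match l, hperm.length_eq with
    | [a, b, c, d, e, f, g, h], _ => exact ⟨a, b, c, d, e, f, g, h, rfl⟩
  have hprod := halves_eq hp
  have hx : List.ofFn x = [0, 1, 2, 3, 4, 5, 6, 7].map x := rfl
  rw [hx] at h hprod
  have h1 := h.2 _ (hperm.map x) (by
    rw [← hprod]
    simp only [List.map_cons, List.map_nil, List.prod_cons, List.prod_nil, mul_assoc, mul_one]
    rfl)
  have hinj : Function.Injective x := List.nodup_ofFn.1 (by rw [hx]; exact h.1)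
  exact hne (hinj.list_map h1)

end

theorem mem_full (g : A₅) : Mem full g := by
  have : full = 2 ^ 60 - 1 := rfl
  rw [Mem, this, Nat.testBit_two_pow_sub_one, decide_eq_true (pt_lt g)]

theorem mem_land {m n : Nat} {g : A₅} (h : Mem m g) (h' : Mem n g) : Mem (Nat.land m n) g := by
  have : (m &&& n).testBit (pt g) = true := by rw [Nat.testBit_and, h, h']; rfl
  exact this

theorem mem_dif {m n : Nat} {g : A₅} (h : Mem m g) (h' : ¬ Mem n g) : Mem (dif m n) g := by
  have : (m ^^^ (m &&& n)).testBit (pt g) = true := by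
    rw [Nat.testBit_xor, Nat.testBit_and, h, Bool.eq_false_iff.2 h']; rfl
  exact this

theorem AllBad.mem_dif {D S : Nat} {g q : A₅} {L : Multiset A₅} (h : AllBad S g L) (hD : Mem D q)
    (hq : ¬ Bad g L q) : Mem (dif D S) q := Rewrite.mem_dif hD fun hS => hq (h q hS)

/-- The graph `E` has an edge from `g` to `h`. -/
def Edge (E : Nat) (g h : A₅) : Prop := Mem (nb E (lab g)) h

theorem dead_false {E r : Nat} {f g h : A₅} (H : dead E r = true)
    (hf : Mem r f) (hg : Mem r g) (hh : Mem r h) (fg : Edge E f g) (fh : Edge E f h)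
    (gh : Edge E g h) : False := by
  simp only [dead, ev_eq] at H
  have h2 := Nat.eq_of_beq_eq_true (allB_mem (allB_mem H hf) (mem_land hg fg))
  have h3 := mem_land (mem_land hh fh) gh
  rw [h2, Mem, Nat.zero_testBit] at h3
  cases h3

theorem loops_mem {E r : Nat} {F : Nat → Nat → Nat → Bool} {f g h : A₅} (H : loops E r F = true)
    (hf : Mem r f) (hg : Mem r g) (hh : Mem r h) (fg : Edge E f g) (fh : Edge E f h)
    (gh : Edge E g h) : F (lab f) (lab g) (lab h) = true := by
  simp only [loops, ev_eq] at H
  exact allB_mem (allB_mem (allB_mem H hf) (mem_land hg fg)) (mem_land (mem_land hh fh) gh)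

theorem graph_fuel (x y z p D : Nat) (k : Nat → Bool) (n : Nat) : ∀ E m,
    Nat.rec (motive := fun _ => Nat → Nat → Bool) (fun _ _ => false)
    (fun _ ih E m => Nat.rec (k E) (fun m _ =>
      ev (Nat.gcd (Nat.add m 1) 1152921504606846976) fun b => ev (Nat.mod b 61) fun q => ev (step p q) fun d =>
        ev (Nat.lor E (Nat.shiftLeft (dif D (F4 x y z d q)) (Nat.mul 60 q))) fun E' => ih E' (Nat.xor (Nat.add m 1) b)) m)
      n E m = true →
    ∃ E', k E' = true ∧ (∀ i, E.testBit i = true → E'.testBit i = true) ∧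
      ∀ j < 60, m.testBit j = true →
        ∀ i, (dif D (F4 x y z (step p (2 ^ j % 61)) (2 ^ j % 61))).testBit i = true →
          E'.testBit (60 * (2 ^ j % 61) + i) = true := by
  simp only [ev_eq]
  induction n with
  | zero => intro E m h; cases h
  | succ n ih =>
    intro E m h
    cases m with
    | zero => exact ⟨E, h, fun _ => id, fun j _ hj => by simp at hj⟩
    | succ m =>
      obtain ⟨i, hi, e⟩ := (Nat.dvd_prime_pow Nat.prime_two (i := Nat.gcd (m + 1) (2 ^ 60))).1
        (Nat.gcd_dvd_right _ _)
      have e' : Nat.gcd (Nat.add m 1) 1152921504606846976 = 2 ^ i := e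
      simp only [e'] at h
      obtain ⟨E', hk, hE, hm⟩ := ih _ _ h
      have hE' (i' : Nat) (h' : (E ||| (dif D (F4 x y z (step p (2 ^ i % 61)) (2 ^ i % 61))) <<<
        (60 * (2 ^ i % 61))).testBit i' = true) : E'.testBit i' = true := hE i' h'
      refine ⟨E', hk, fun t ht => hE' t (by rw [Nat.testBit_or, ht]; rfl), fun j hj hb t ht => ?_⟩
      by_cases hij : j = i
      · rw [hij] at ht ⊢
        exact hE' _ (by
          rw [Nat.testBit_or, Nat.testBit_shiftLeft, Nat.add_sub_cancel_left, ht]; simp)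
      · refine hm j hj ?_ t ht
        have : Nat.xor (Nat.add m 1) (2 ^ i) = (m + 1) ^^^ 2 ^ i := rfl
        rw [this, Nat.testBit_xor, hb, Nat.testBit_two_pow_of_ne (Ne.symm hij)]; rfl

theorem exists_graph {x y z p D : Nat} {k : Nat → Bool} (H : graph x y z p D k = true) :
    ∃ E, k E = true ∧ ∀ g h : A₅, Mem D g →
      Mem (dif D (F4 x y z (step p (lab g)) (lab g))) h → Edge E g h := by
  obtain ⟨E, hk, -, hE⟩ := graph_fuel x y z p D k 61 _ D H
  refine ⟨E, hk, fun g h hg hh => ?_⟩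
  have := hE (pt g) (pt_lt g) hg (pt h) (by rw [two_pow_pt]; exact hh)
  rw [two_pow_pt] at this
  have e : nb E (lab g) = E >>> (60 * lab g) := rfl
  rwa [Edge, e, Mem, Nat.testBit_shiftRight]

theorem of_orB {a b : Bool} (h : orB a b = true) (ha : a = true → False) : b = true :=
  (orB_eq_true.1 h).resolve_left ha

theorem of_ev {n : Nat} {f : Nat → Bool} (h : ev n f = true) : f n = true := (ev_eq n f).symm.trans h

theorem of_search {c x y p : Nat} (h : search c x y = true) (hp : iv (ix (R x ◃ c1 y)) = p) :
    allB (fun q => ev q fun q => ev (step p q) fun z => orB (low c y z)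
      (node c x y z q (dif full (F2 x y p)))) (dif full (F2 x y p)) = true := by
  rw [search] at h
  have h := of_ev h
  rw [hp] at h
  have h := of_ev h
  exact h

theorem Rigid.mem_dif {A B C : List A₅} (h : Rigid (A ++ B ++ C)) (hB : B ≠ []) {g q : A₅} {S D : Nat}
    (hg : g = A.prod) (hq : q = (A ++ B).prod) (hS : AllBad S g (A.map (·⁻¹) : List A₅))
    (hD : Mem D q) : Mem (dif D S) q := by
  subst hg hq
  exact hS.mem_dif hD (h.not_bad hB)

section
attribute [local irreducible] R c0 c1 c2 invTable T F2 F3 F4 F5a F5b F5c iv ix full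

theorem Rigid.edge {E D : Nat} {x y z p q r : A₅} {M B C : List A₅}
    (h : Rigid ([x, y, z] ++ M ++ B ++ C)) (hM : M ≠ []) (hB : B ≠ []) (hp : p = x * y * z)
    (hE : ∀ g h : A₅, Mem D g → Mem (dif D (F4 (lab x⁻¹) (lab y⁻¹) (lab z⁻¹) (step (lab p) (lab g))
      (lab g))) h → Edge E g h)
    (hq : q = ([x, y, z] ++ M).prod) (hr : r = ([x, y, z] ++ M ++ B).prod)
    (hDq : Mem D q) (hDr : Mem D r) : Edge E q r := by
  refine hE q r hDq ?_
  rw [step_lab]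
  refine (allBad_F4 _ _ _ _ _).mem_dif hDr fun hb => ?_
  have e : q⁻¹ * p = ((M.map (·⁻¹)).reverse).prod := by
    rw [← List.prod_inv_reverse, hq, hp]
    simp [mul_assoc]
  rw [e] at hb
  have hb' := hb.split (by simpa using hM)
  rw [hq, hr] at hb'
  refine h.not_bad hB ?_
  convert hb' using 1
  rw [Multiset.coe_eq_coe.2 (List.reverse_perm _), List.map_append, ← Multiset.coe_add]
  rfl

theorem search_false {k : Nat} {x y z d e f g h : A₅} (hr : Rigid [x, y, z, d, e, f, g, h])
    (hs : search k (lab x⁻¹) (lab y⁻¹) = true)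
    (hyz : low k (lab y⁻¹) (lab z⁻¹) = true → False)
    (hzd : low k (lab z⁻¹) (lab d⁻¹) = true → False)
    (hde : low k (lab d⁻¹) (lab e⁻¹) = true → False) : False := by
  have st (p q : A₅) : step (lab p) (lab (p * q)) = lab q⁻¹ := by
    rw [step_lab, mul_inv_rev, inv_mul_cancel_right]
  have e2 : iv (ix (R (lab x⁻¹) ◃ c1 (lab y⁻¹))) = lab (x * y) := by
    rw [R_c1, ix_c2, iv, inv_c1, ix_c2]; simp
  have hs := of_search hs e2
  have m2 {q : A₅} (B C : List A₅) (hB : B ≠ []) (hq : q = ([x, y] ++ B).prod)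
      (h : Rigid ([x, y] ++ B ++ C)) :
      Mem (dif full (F2 (lab x⁻¹) (lab y⁻¹) (lab (x * y)))) q :=
    h.mem_dif hB (by simp) hq (allBad_F2 _ _ _) (mem_full q)
  have h3 := allB_mem hs
    (m2 (q := x * y * z) [z] [d, e, f, g, h] (by simp) (by simp [mul_assoc]) hr)
  have h3 := of_ev h3
  have h3 := of_ev h3
  rw [st] at h3
  have hn := of_orB h3 hyz
  rw [node] at hn
  have hn := of_ev hn
  obtain ⟨E, hk, hE⟩ := exists_graph hn
  have m3 {q : A₅} (B C : List A₅) (hB : B ≠ []) (hq : q = ([x, y, z] ++ B).prod)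
      (h : Rigid ([x, y, z] ++ B ++ C)) :
      Mem (dif (dif full (F2 (lab x⁻¹) (lab y⁻¹) (lab (x * y))))
        (F3 (lab x⁻¹) (lab y⁻¹) (lab z⁻¹) (lab (x * y * z)))) q :=
    h.mem_dif hB (by simp [mul_assoc]) hq (allBad_F3 _ _ _ _)
      (m2 (z :: B) C (by simp) hq h)
  generalize dif (dif full (F2 (lab x⁻¹) (lab y⁻¹) (lab (x * y))))
    (F3 (lab x⁻¹) (lab y⁻¹) (lab z⁻¹) (lab (x * y * z))) = D at hk hE m3
  have ed {q r : A₅} (M B C : List A₅) (h : Rigid ([x, y, z] ++ M ++ B ++ C)) (hM : M ≠ [])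
      (hB : B ≠ []) (hq : q = ([x, y, z] ++ M).prod) (hr : r = ([x, y, z] ++ M ++ B).prod) :
      Edge E q r := by
    refine h.edge hM hB rfl hE hq hr (m3 M (B ++ C) hM hq (by simpa using h))
      (m3 (M ++ B) C (by simp [hM]) (by simpa using hr) (by simpa using h))
  rw [edges] at hk
  have g4 := m3 (q := x * y * z * d) [d] [e, f, g, h] (by simp) (by simp [mul_assoc]) hr
  have h4 := allB_mem hk g4
  have h4 := of_ev h4
  have h4 := of_ev h4
  rw [st] at h4
  have h4 := of_orB h4 hzd
  have h4 := of_ev h4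
  have h5 := allB_mem h4 (g := x * y * z * d * e) (mem_land (mem_full _)
    (ed [d] [e] [f, g, h] hr (by simp) (by simp) (by simp [mul_assoc]) (by simp [mul_assoc])))
  have h5 := of_ev h5
  have h5 := of_ev h5
  rw [st] at h5
  have h6 := of_orB h5 hde
  have h6 := of_ev h6
  have e67 : Edge E (x * y * z * d * e * f) (x * y * z * d * e * f * g) :=
    ed [d, e, f] [g] [h] hr (by simp) (by simp) (by simp [mul_assoc]) (by simp [mul_assoc])
  have e68 : Edge E (x * y * z * d * e * f) (x * y * z * d * e * f * g * h) :=
    ed [d, e, f] [g, h] [] hr (by simp) (by simp) (by simp [mul_assoc]) (by simp [mul_assoc])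
  have e78 : Edge E (x * y * z * d * e * f * g) (x * y * z * d * e * f * g * h) :=
    ed [d, e, f, g] [h] [] hr (by simp) (by simp) (by simp [mul_assoc]) (by simp [mul_assoc])
  have m5 {q : A₅} {S r : Nat} (hS : AllBad S (x * y * z * d * e)
      ({x⁻¹} + {y⁻¹} + {z⁻¹} + {d⁻¹} + {e⁻¹})) (B C : List A₅) (hB : B ≠ [])
      (hq : q = ([x, y, z, d, e] ++ B).prod) (h : Rigid ([x, y, z, d, e] ++ B ++ C))
      (hm : Mem r q) : Mem (dif r S) q :=
    h.mem_dif hB (by simp [mul_assoc]) hq hS hm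
  have next {S r : Nat} (hS : AllBad S (x * y * z * d * e)
      ({x⁻¹} + {y⁻¹} + {z⁻¹} + {d⁻¹} + {e⁻¹}))
      (hm : Mem r (x * y * z * d * e * f) ∧ Mem r (x * y * z * d * e * f * g) ∧
        Mem r (x * y * z * d * e * f * g * h)) :
      Mem (dif r S) (x * y * z * d * e * f) ∧ Mem (dif r S) (x * y * z * d * e * f * g) ∧
        Mem (dif r S) (x * y * z * d * e * f * g * h) :=
    ⟨m5 hS [f] [g, h] (by simp) (by simp [mul_assoc]) hr hm.1,
      m5 hS [f, g] [h] (by simp) (by simp [mul_assoc]) hr hm.2.1,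
      m5 hS [f, g, h] [] (by simp) (by simp [mul_assoc]) hr hm.2.2⟩
  have alive {r : Nat} {b : Bool} (H : orB (dead E r) b = true)
      (hm : Mem r (x * y * z * d * e * f) ∧ Mem r (x * y * z * d * e * f * g) ∧
        Mem r (x * y * z * d * e * f * g * h)) : b = true :=
    of_orB H fun h => dead_false h hm.1 hm.2.1 hm.2.2 e67 e68 e78
  have start {q : A₅} (B C : List A₅) (h : Rigid ([x, y, z] ++ [d] ++ ([e] ++ B) ++ C)) (hB : B ≠ [])
      (hq : q = ([x, y, z, d, e] ++ B).prod) :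
      Mem (Nat.land (Nat.land full (nb E (lab (x * y * z * d)))) (nb E (lab (x * y * z * d * e)))) q :=
    mem_land (mem_land (mem_full _) (ed [d] ([e] ++ B) C h (by simp) (by simp)
      (by simp [mul_assoc]) hq)) (ed [d, e] B C h (by simp) hB (by simp [mul_assoc]) hq)
  have r0 := And.intro (start [f] [g, h] hr (by simp) (by simp [mul_assoc] : x * y * z * d * e * f = _))
    (And.intro (start [f, g] [h] hr (by simp) (by simp [mul_assoc] : x * y * z * d * e * f * g = _))
     (start [f, g, h] [] hr (by simp) (by simp [mul_assoc] : x * y * z * d * e * f * g * h = _)))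
  have r1 := next (allBad_F5a _ _ _ _ _ _) r0
  have r2 := next (allBad_F5b _ _ _ _ _ _) r1
  have r3 := next (allBad_F5c _ _ _ _ _ _) r2
  have hl := alive h6 r0
  have hl := of_ev hl
  have hl := alive hl r1
  have hl := of_ev hl
  have hl := alive hl r2
  have hl := of_ev hl
  have hf := loops_mem hl r3.1 r3.2.1 r3.2.2 e67 e68 e78
  rw [final] at hf
  have hf := of_ev hf
  have hf := of_ev hf
  have hf := of_ev hf
  rw [st, st, st] at hf
  have e8 : x * y * z * d * e * f * g * h = [x, y, z, d, e, f, g, h].prod := by simp [mul_assoc]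
  rw [e8] at hf
  exact Rigid.someWord (x := ![x, y, z, d, e, f, g, h]) (by simpa using hr) (by simpa using hf)

end

def outerLabel (t : Nat) : Nat := Nat.add (digit outerDigits 6 (Nat.sub t 1)) 1

/-- Apply the symmetry coded by `s` to a label. -/
def act (s a : Nat) : Nat := ev (Nat.add (Nat.land s 63) 1) fun t =>
  ev (Bool.rec a (outerLabel a) (Nat.testBit s 6)) fun a => mulLabel (mulLabel t a) (invLabel t)

def repX (r : Nat) : Nat := digit repDigits 6 (2 * r + 1)
def repY (r : Nat) : Nat := digit repDigits 6 (2 * r)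

def maps (s r a b : Nat) : Bool := andB (Nat.beq (act s a) (repX r)) (Nat.beq (act s b) (repY r))

def rankCorrect (y z d : Nat) : Bool :=
  Nat.rec (Nat.beq (mulLabel y z) (mulLabel z y)) (fun r _ => andB (Nat.blt r 19)
    (ev (digit symmetryDigits 8 (Nat.add (Nat.mul 60 (Nat.sub y 1)) (Nat.sub z 1))) fun s =>
      andB (Nat.blt (Nat.land s 63) 60)
        (Bool.rec (maps s r y z) (maps s r (invLabel z) (invLabel y)) (Nat.testBit s 7)))) d

def ranksCorrect : Bool := allLabels fun y => allLabels fun z =>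
  ev (digit (rankRow y) 5 (Nat.sub z 1)) fun d => rankCorrect y z d

theorem ranksCorrect_eq : ranksCorrect = true := by decide +kernel

theorem image_outerLabel : ∀ i : Fin 60, ∀ x : Fin 5,
    image (outerLabel (i + 1)) x = Equiv.swap 0 1 (image (i + 1) (Equiv.swap 0 1 x)) := by
  decide +kernel

theorem outerLabel_bounds : ∀ i : Fin 60, 1 ≤ outerLabel (i + 1) ∧ outerLabel (i + 1) ≤ 60 := by
  decide +kernel

theorem lab_conj_swap (g : A₅) :
    lab (MulAut.conjNormal (Equiv.swap (0 : Fin 5) 1) g) = outerLabel (lab g) := by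
  refine lab_eq (outerLabel_bounds (elemEquiv.symm g)) fun x => ?_
  rw [lab, image_outerLabel]
  change Equiv.swap 0 1 (image (lab g) _) = _
  rw [image_lab]
  simp [MulAut.conjNormal_apply]

theorem exists_act {s : Nat} (hs : Nat.blt (Nat.land s 63) 60 = true) :
    ∃ φ : MulAut A₅, ∀ g, lab (φ g) = act s (lab g) := by
  have hs' : Nat.land s 63 < 60 := by simpa [Nat.blt_eq] using hs
  obtain ⟨t, ht⟩ := exists_lab (t := Nat.land s 63 + 1) (by omega)
  rcases hb : Nat.testBit s 6 with _ | _
  · refine ⟨MulAut.conj t, fun g => ?_⟩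
    simp only [act, ev_eq, hb]
    rw [MulAut.conj_apply, lab_mul, lab_mul, lab_inv, ht]
  · refine ⟨MulAut.conj t * MulAut.conjNormal (Equiv.swap (0 : Fin 5) 1), fun g => ?_⟩
    simp only [act, ev_eq, hb]
    rw [MulAut.mul_apply, MulAut.conj_apply, lab_mul, lab_mul, lab_inv, lab_conj_swap, ht]

/-- `(x, y)` represents the class `r` of pairs. -/
def IsRep (r : Nat) (x y : A₅) : Prop := lab x⁻¹ = repX r ∧ lab y⁻¹ = repY r

theorem maps_eq {s r : Nat} {x y : A₅} {φ : MulAut A₅} (hφ : ∀ g, lab (φ g) = act s (lab g))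
    (h : maps s r (lab x⁻¹) (lab y⁻¹) = true) : IsRep r (φ x) (φ y) := by
  have h := andB_eq_true.1 h
  refine ⟨?_, ?_⟩
  · rw [← map_inv, hφ]; exact Nat.eq_of_beq_eq_true h.1
  · rw [← map_inv, hφ]; exact Nat.eq_of_beq_eq_true h.2

theorem rank_spec (y z : A₅) {d : Nat} (hd : digit (rankRow (lab y⁻¹)) 5 (Nat.sub (lab z⁻¹) 1) = d) :
    (y * z = z * y) ∨ ∃ r < 19, d = r + 1 ∧ ∃ φ : MulAut A₅,
      IsRep r (φ y) (φ z) ∨ IsRep r (φ z⁻¹) (φ y⁻¹) := by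
  have h := allLabels_lab (allLabels_lab ranksCorrect_eq y⁻¹) z⁻¹
  rw [ev_eq, hd] at h
  cases d with
  | zero =>
    left
    have h := Nat.eq_of_beq_eq_true h
    rw [← lab_mul, ← lab_mul] at h
    have h := congrArg (·⁻¹) (lab_injective h)
    simpa using h.symm
  | succ r =>
    right
    have h := andB_eq_true.1 h
    rw [ev_eq] at h
    obtain ⟨hr, h⟩ := h
    generalize digit symmetryDigits 8 _ = s at h
    have h := andB_eq_true.1 h
    obtain ⟨φ, hφ⟩ := exists_act h.1
    refine ⟨r, by simpa [Nat.blt_eq] using hr, rfl, φ, ?_⟩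
    rcases hb : Nat.testBit s 7 with _ | _
    · rw [hb] at h
      exact Or.inl (maps_eq hφ h.2)
    · rw [hb, ← lab_inv, ← lab_inv] at h
      exact Or.inr (maps_eq hφ h.2)

/-- No relator of length 9 that starts with a pair of class `r` is rigid. -/
def NoRelator (r : Nat) : Prop :=
  ∀ (x y : A₅) (L : List A₅), IsRep r x y → L.length = 7 → ¬ CycRigid (x :: y :: L)

theorem CycRigid.false_of_rank {y z : A₅} {L : List A₅} (h : CycRigid (y :: z :: L))
    (hL : L.length = 7) {c : Nat} (hc : ∀ r < c, r < 19 → NoRelator r)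
    (hr : digit (rankRow (lab y⁻¹)) 5 (Nat.sub (lab z⁻¹) 1) ≤ c) : False := by
  rcases rank_spec y z rfl with hcomm | ⟨r, hr', hd, φ, hφ | hφ⟩
  · obtain ⟨M, w, rfl⟩ := (List.eq_nil_or_concat L).resolve_left (by rintro rfl; simp at hL)
    rw [List.concat_eq_append] at h
    exact Rigid.not_commute (A := []) (CycRigid.rigid (L := y :: z :: M) h) hcomm
  · exact hc r (by omega) hr' _ _ (L.map φ) hφ (by simpa using hL) (h.map φ)
  · have h' := h.inv_reverse
    simp only [List.map_cons, List.reverse_cons, List.append_assoc] at h'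
    have h' := h'.rotated List.isRotated_append
    exact hc r (by omega) hr' _ _ (((L.map (·⁻¹)).reverse).map φ) hφ (by simpa using hL)
      (h'.map φ)

theorem CycRigid.false_of_low {y z : A₅} {A B : List A₅} (h : CycRigid (A ++ y :: z :: B))
    (hL : A.length + B.length = 7) {c : Nat} (hc : ∀ r < c, r < 19 → NoRelator r)
    (hr : low c (lab y⁻¹) (lab z⁻¹) = true) : False :=
  CycRigid.false_of_rank (h.rotated List.isRotated_append) (by simp; omega) hc
    (Nat.le_of_ble_eq_true hr)

theorem noRelator (hs : ∀ r < 19, search r (repX r) (repY r) = true) :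
    ∀ r < 19, NoRelator r := by
  intro r
  induction r using Nat.strong_induction_on with
  | _ r ih =>
    intro hr x y L hxy hL h
    obtain ⟨z, d, e, f, g, k, w, rfl⟩ : ∃ a b c d e f g, L = [a, b, c, d, e, f, g] := by
      match L, hL with
      | [a, b, c, d, e, f, g], _ => exact ⟨a, b, c, d, e, f, g, rfl⟩
    have hs := hs r hr
    rw [← hxy.1, ← hxy.2] at hs
    exact search_false (CycRigid.rigid (L := [x, y, z, d, e, f, g, k]) h) hs
      (CycRigid.false_of_low (A := [x]) h rfl ih) (CycRigid.false_of_low (A := [x, y]) h rfl ih)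
      (CycRigid.false_of_low (A := [x, y, z]) h rfl ih)

theorem not_rigid (hs : ∀ r < 19, search r (repX r) (repY r) = true) {L : List A₅}
    (hL : L.length = 8) : ¬ Rigid L := by
  intro h
  have hc := h.cycRigid (by rw [hL]; decide)
  match L, hL with
  | x :: y :: M, hL =>
    refine CycRigid.false_of_rank (c := 19) (hc.rotated (List.isRotated_append (l := [_])))
      (by simpa using hL) (fun r _ hr => noRelator hs r hr) ?_
    rcases rank_spec x y rfl with hcomm | ⟨r, hr, hd, -⟩
    · exact (Rigid.not_commute (A := []) h hcomm).elim
    · omega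

theorem rewProp_of_not_rigid {G : Type*} [Group G] {n : ℕ}
    (h : ∀ L : List G, L.length = n → ¬ Rigid L) : RewProp G n := by
  intro x
  by_contra! hx
  have hx' : Function.Injective x := by
    intro i j hij
    by_contra hne
    refine hx (Equiv.swap i j) (by simpa [Equiv.swap_eq_one_iff] using hne) ?_
    congr 2
    ext k
    rw [Function.comp_apply, Equiv.swap_apply_def]
    split_ifs with h1 h2
    · rw [h1, hij]
    · rw [h2, hij]
    · rfl
  refine h (List.ofFn x) List.length_ofFn ⟨List.nodup_ofFn.2 hx', fun l hl hp => ?_⟩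
  · have hlen : l.length = n := by rw [hl.length_eq, List.length_ofFn]
    obtain ⟨y, rfl⟩ : ∃ y : Fin n → G, l = List.ofFn y := by
      subst hlen; exact ⟨l.get, (List.ofFn_get l).symm⟩
    have hs (i) : ∃ j, x j = y i :=
      List.mem_ofFn.1 (hl.mem_iff.1 (List.mem_ofFn.2 ⟨i, rfl⟩))
    choose s hs using hs
    have hy : Function.Injective y := List.nodup_ofFn.1 (hl.nodup_iff.2 (List.nodup_ofFn.2 hx'))
    have hsi : Function.Injective s := fun i j hij => hy (by rw [← hs, ← hs, hij])
    let σ := Equiv.ofBijective s (Finite.injective_iff_bijective.1 hsi)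
    have hσ : x ∘ σ = y := funext hs
    rw [← hσ] at hp ⊢
    by_cases h1 : σ = 1
    · rw [h1]; rfl
    · exact absurd hp.symm (hx σ h1)

theorem RewProp.succ {G : Type*} [Group G] {n : ℕ} (h : RewProp G n) : RewProp G (n + 1) := by
  intro x
  obtain ⟨σ, hσ, e⟩ := h fun i => x i.succ
  refine ⟨Equiv.Perm.decomposeFin.symm (0, σ), fun h1 => hσ ?_, ?_⟩
  · ext i
    have := congrArg (fun τ : Equiv.Perm (Fin (n + 1)) => τ i.succ) h1
    simp only [Equiv.Perm.decomposeFin_symm_apply_succ, Equiv.swap_self, Equiv.refl_apply,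
      Equiv.Perm.one_apply, Fin.succ_inj] at this
    rw [this, Equiv.Perm.one_apply]
  · rw [List.ofFn_succ, List.ofFn_succ, List.prod_cons, List.prod_cons, e]
    simp [Function.comp_def]

/-- The labels of a sequence that cannot be rewritten. -/
def rigidLabels : List Nat := [33, 39, 3, 57, 55, 56, 24]

theorem rigidLabels_all : (rigidLabels.permutations'.all fun l =>
    orB (Nat.beq (l.foldr mulLabel 1) (rigidLabels.foldr mulLabel 1)).not
      (decide (l = rigidLabels))) = true := by decide +kernel

theorem rigidLabels_rigid {l : List Nat} (hl : l.Perm rigidLabels)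
    (e : l.foldr mulLabel 1 = rigidLabels.foldr mulLabel 1) : l = rigidLabels := by
  have h := orB_eq_true.1 (List.all_eq_true.1 rigidLabels_all l (List.mem_permutations'.2 hl))
  rw [e, Nat.beq_refl] at h
  exact of_decide_eq_true (h.resolve_left (by simp))

theorem lab_prod (l : List A₅) : lab l.prod = (l.map lab).foldr mulLabel 1 := by
  induction l with
  | nil => exact lab_one
  | cons a l ih => rw [List.prod_cons, lab_mul, ih]; rfl

theorem not_rewProp_seven : ¬ RewProp A₅ 7 := by
  intro h
  have hx (i : Fin 7) : ∃ g, lab g = ![33, 39, 3, 57, 55, 56, 24] i :=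
    exists_lab (by fin_cases i <;> simp)
  choose x hx using hx
  have hlist : (List.ofFn x).map lab = rigidLabels := by
    rw [List.map_ofFn, show lab ∘ x = ![33, 39, 3, 57, 55, 56, 24] from funext hx]; rfl
  obtain ⟨σ, hσ, e⟩ := h x
  have hperm : ((List.ofFn (x ∘ σ)).map lab).Perm rigidLabels := by
    rw [← hlist]; exact (σ.ofFn_comp_perm x).map lab
  have h1 := rigidLabels_rigid hperm (by
    rw [← lab_prod, ← hlist, ← lab_prod, e])
  rw [← hlist] at h1
  have h2 := List.ofFn_injective (lab_injective.list_map h1)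
  refine hσ (Equiv.ext fun i => ?_)
  have hinj : Function.Injective x := by
    refine List.nodup_ofFn.1 (List.Nodup.of_map lab ?_)
    rw [hlist]; decide
  exact hinj (congrFun h2 i)

theorem not_rewProp_of_le_seven {n : ℕ} (hn : n ≤ 7) : ¬ RewProp A₅ n := fun h =>
  not_rewProp_seven (Nat.le_induction (P := fun m _ => RewProp A₅ m) h (fun _ _ => RewProp.succ) 7 hn)

/-- The searches for the classes `n, …, n + k - 1` find no relator. -/
def searches (n k : Nat) : Bool :=
  Nat.rec true (fun i ih => ev (Nat.add n i) fun r => ev (repX r) fun x => ev (repY r) fun y =>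
    andB (search r x y) ih) k

theorem search_of_searches {n k r : Nat} (h : searches n k = true) (hn : n ≤ r) (hr : r < n + k) :
    search r (repX r) (repY r) = true := by
  induction k with
  | zero => omega
  | succ k ih =>
    have h : (ev (Nat.add n k) fun r => ev (repX r) fun x => ev (repY r) fun y =>
      andB (search r x y) (searches n k)) = true := h
    rw [ev_eq, ev_eq, ev_eq] at h
    have h := andB_eq_true.1 h
    rcases Nat.lt_or_ge r (n + k) with hk | hk
    · exact ih h.2 hk
    · have e : r = Nat.add n k := Nat.le_antisymm (Nat.le_of_lt_succ hr) hk
      rw [e]; exact h.1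

theorem searches_six_to_eighteen : searches 6 13 = true := by decide +kernel
theorem searches_four_five : searches 4 2 = true := by decide +kernel
theorem searches_three : searches 3 1 = true := by decide +kernel
theorem searches_two : searches 2 1 = true := by decide +kernel
theorem searches_one : searches 1 1 = true := by decide +kernel
theorem searches_zero : searches 0 1 = true := by decide +kernel

theorem search_rep (r : Nat) (hr : r < 19) : search r (repX r) (repY r) = true := by
  rcases Nat.lt_or_ge r 6 with h | h
  · rcases Nat.lt_or_ge r 4 with h | h
    · obtain rfl | rfl | rfl | rfl : r = 0 ∨ r = 1 ∨ r = 2 ∨ r = 3 := by omega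
      · exact search_of_searches searches_zero (by omega) (by omega)
      · exact search_of_searches searches_one (by omega) (by omega)
      · exact search_of_searches searches_two (by omega) (by omega)
      · exact search_of_searches searches_three (by omega) (by omega)
    · exact search_of_searches searches_four_five h (by omega)
  · exact search_of_searches searches_six_to_eighteen h (by omega)

end Rewrite
end

/-- `8` is the least integer `n > 1` such that `A₅` satisfies `Pₙ`:
`A₅` satisfies `P₈` but not `Pₙ` for any `2 ≤ n ≤ 7`. -/
theorem A5_rewritability_length_eight :
    RewProp (alternatingGroup (Fin 5)) 8 ∧
      ∀ n : ℕ, 2 ≤ n → n ≤ 7 → ¬ RewProp (alternatingGroup (Fin 5)) n := by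
  exact ⟨Rewrite.rewProp_of_not_rigid fun _ hL => Rewrite.not_rigid Rewrite.search_rep hL,
    fun _ _ hn => Rewrite.not_rewProp_of_le_seven hn⟩
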